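/- arXiv:1310.7379 — 2 statements merged into one kernel-verified Lean document; each statement's English description precedes it below -/
import Mathlib

section
/- Let n ≥ 1 and k ≥ 0 with 3k ≤ n, and set λ = (3^k, 1^{n−3k}), the partition of n with k parts equal to 3 and n−3k parts equal to 1. Let μ be any partition of n all of whose parts are odd. Then O_λ ≤ O_μ if and only if μ ⊴ λ in the dominance order. -/
/-- A word in the adjacent transpositions `s_i = (i, i+1)` (0-based: `swap i (i+1)`),
the standard Coxeter generators of `𝔖_n = Equiv.Perm (Fin n)`. -/
def IsAdjWord (n : ℕ) (l : List (Equiv.Perm (Fin n))) : Prop :=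
  ∀ x ∈ l, ∃ i : ℕ, ∃ h : i + 1 < n, x = Equiv.swap ⟨i, Nat.lt_of_succ_lt h⟩ ⟨i + 1, h⟩

/-- The Coxeter length of a permutation: the minimal length of an expression as a
product of adjacent transpositions. -/
noncomputable def permLength (n : ℕ) (w : Equiv.Perm (Fin n)) : ℕ :=
  sInf {k | ∃ l : List (Equiv.Perm (Fin n)), IsAdjWord n l ∧ l.length = k ∧ l.prod = w}

/-- The Bruhat order on `𝔖_n`: `x ≤ y` iff some reduced expression of `y` contains a
subword that is a reduced expression of `x`. -/
def permBruhatLE (n : ℕ) (x y : Equiv.Perm (Fin n)) : Prop :=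
  ∃ l : List (Equiv.Perm (Fin n)), IsAdjWord n l ∧ l.prod = y ∧ l.length = permLength n y ∧
    ∃ l' : List (Equiv.Perm (Fin n)), l'.Sublist l ∧ l'.prod = x ∧ l'.length = permLength n x

/-- The cycle type of a permutation of `{1,…,n}`, including fixed points as parts equal
to `1`; this is a partition of `n`, regarded as a multiset. -/
def fullCycleType (n : ℕ) (w : Equiv.Perm (Fin n)) : Multiset ℕ :=
  w.cycleType + Multiset.replicate (n - w.cycleType.sum) 1

/-- Membership in the `F`-conjugacy class `O_μ = {w : w·w₀ has cycle type μ}`, where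
`w₀` is the longest element `i ↦ n+1−i` (0-based: `Fin.revPerm`). -/
def inClass (n : ℕ) (mu : Multiset ℕ) (w : Equiv.Perm (Fin n)) : Prop :=
  fullCycleType n (w * Fin.revPerm) = mu

/-- `w` is an element of minimal Coxeter length in the class `O_μ`. -/
def isMinimalIn (n : ℕ) (mu : Multiset ℕ) (w : Equiv.Perm (Fin n)) : Prop :=
  inClass n mu w ∧ ∀ z : Equiv.Perm (Fin n), inClass n mu z → permLength n w ≤ permLength n z

/-- The partial order on `F`-conjugacy classes: `O_μ ≤ O_λ` iff for every minimal length
element `x` of `O_λ` there is a minimal length element `x'` of `O_μ` with `x' ≤ x`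
in the Bruhat order. -/
def classLE (n : ℕ) (mu lam : Multiset ℕ) : Prop :=
  ∀ x : Equiv.Perm (Fin n), isMinimalIn n lam x →
    ∃ x' : Equiv.Perm (Fin n), isMinimalIn n mu x' ∧ permBruhatLE n x' x

/-- The dominance order on partitions (as multisets of parts): `μ ⊴ λ` iff for each `i`,
the sum of the `i` largest parts of `μ` is at most that of `λ`. -/
def domLE (mu lam : Multiset ℕ) : Prop :=
  ∀ i : ℕ, ((mu.sort (· ≥ ·)).take i).sum ≤ ((lam.sort (· ≥ ·)).take i).sum


namespace S6

/-- number of inversions -/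
def invSet (n : ℕ) (w : Equiv.Perm (Fin n)) : Finset (Fin n × Fin n) :=
  Finset.univ.filter (fun p => p.1 < p.2 ∧ w p.2 < w p.1)

lemma mem_invSet {n : ℕ} {w : Equiv.Perm (Fin n)} {p : Fin n × Fin n} :
    p ∈ invSet n w ↔ p.1 < p.2 ∧ w p.2 < w p.1 := by
  simp [invSet]

abbrev adj (n i : ℕ) (h : i + 1 < n) : Equiv.Perm (Fin n) :=
  Equiv.swap ⟨i, Nat.lt_of_succ_lt h⟩ ⟨i + 1, h⟩

lemma swap_val (n i : ℕ) (h : i + 1 < n) (a : Fin n) :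
    ((adj n i h a : Fin n) : ℕ) =
      if (a : ℕ) = i then i + 1 else if (a : ℕ) = i + 1 then i else a := by
  simp only [adj, Equiv.swap_apply_def, Fin.ext_iff]
  split_ifs <;> rfl

lemma swap_lt_iff (n i : ℕ) (h : i + 1 < n) (a b : Fin n) (hab : a < b)
    (hne : ¬ ((a : ℕ) = i ∧ (b : ℕ) = i + 1)) : adj n i h a < adj n i h b := by
  rw [Fin.lt_def, swap_val, swap_val]
  rw [Fin.lt_def] at hab
  split_ifs <;> omega

lemma inv_step (n i : ℕ) (h : i + 1 < n) (w : Equiv.Perm (Fin n)) :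
    ((invSet n (w * adj n i h)).erase (⟨i, Nat.lt_of_succ_lt h⟩, ⟨i + 1, h⟩)).card ≤
      ((invSet n w).erase (⟨i, Nat.lt_of_succ_lt h⟩, ⟨i + 1, h⟩)).card := by
  apply Finset.card_le_card_of_injOn (fun p => (adj n i h p.1, adj n i h p.2))
  · rintro ⟨a, b⟩ hp
    simp only [Finset.mem_coe, Finset.mem_erase, mem_invSet, ne_eq, Prod.mk.injEq,
      Equiv.Perm.mul_apply] at hp ⊢
    obtain ⟨h3, h1, h2⟩ := hp
    have h3' : ¬ ((a : ℕ) = i ∧ (b : ℕ) = i + 1) := by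
      simpa [Fin.ext_iff] using h3
    refine ⟨?_, swap_lt_iff n i h a b h1 h3', h2⟩
    simp only [Fin.ext_iff, swap_val]
    rw [Fin.lt_def] at h1
    split_ifs <;> omega
  · rintro ⟨a, b⟩ _ ⟨c, d⟩ _ hh
    simp only [Prod.mk.injEq, EmbeddingLike.apply_eq_iff_eq] at hh
    exact Prod.ext hh.1 hh.2

lemma inv_le_succ (n i : ℕ) (h : i + 1 < n) (w : Equiv.Perm (Fin n)) :
    (invSet n (w * adj n i h)).card ≤ (invSet n w).card + 1 := by
  have := inv_step n i h w
  have h1 := Finset.card_erase_le (s := invSet n w) (a := (⟨i, Nat.lt_of_succ_lt h⟩, ⟨i + 1, h⟩))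
  have h2 := Finset.pred_card_le_card_erase (s := invSet n (w * adj n i h))
    (a := (⟨i, Nat.lt_of_succ_lt h⟩, ⟨i + 1, h⟩))
  omega

lemma inv_lt (n i : ℕ) (h : i + 1 < n) (w : Equiv.Perm (Fin n))
    (hd : w ⟨i + 1, h⟩ < w ⟨i, Nat.lt_of_succ_lt h⟩) :
    (invSet n (w * adj n i h)).card + 1 ≤ (invSet n w).card := by
  have := inv_step n i h w
  have h1 : (⟨i, Nat.lt_of_succ_lt h⟩, ⟨i + 1, h⟩) ∈ invSet n w := by
    simp [mem_invSet, hd]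
  have h2 : (⟨i, Nat.lt_of_succ_lt h⟩, ⟨i + 1, h⟩) ∉ invSet n (w * adj n i h) := by
    simp [mem_invSet, hd.le]
  rw [Finset.erase_eq_of_notMem h2] at this
  have := Finset.card_erase_add_one h1
  omega

lemma inv_le_word (n : ℕ) (l : List (Equiv.Perm (Fin n))) (hl : IsAdjWord n l) :
    (invSet n l.prod).card ≤ l.length := by
  induction l using List.reverseRecOn with
  | nil =>
    simp only [List.prod_nil, List.length_nil, Nat.le_zero, Finset.card_eq_zero]
    rw [Finset.eq_empty_iff_forall_notMem]
    intro p hp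
    rw [mem_invSet] at hp
    simp only [Equiv.Perm.one_apply] at hp
    exact absurd hp.1 (not_lt.mpr hp.2.le)
  | append_singleton l s ih =>
    obtain ⟨i, h, rfl⟩ := hl s (by simp)
    have := inv_le_succ n i h l.prod
    have h2 := ih (fun x hx => hl x (by simp [hx]))
    simp only [List.prod_append, List.prod_singleton, List.length_append, List.length_singleton]
    simp only [adj] at this
    omega

lemma perm_eq_one (n : ℕ) (w : Equiv.Perm (Fin n))
    (hw : ∀ i (h : i + 1 < n), w ⟨i, Nat.lt_of_succ_lt h⟩ < w ⟨i + 1, h⟩) : w = 1 := by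
  rcases n with _ | n
  · ext a; exact a.elim0
  have hm : StrictMono w := by
    rw [Fin.strictMono_iff_lt_succ]
    intro i
    exact hw i (by omega)
  have := Subsingleton.elim (StrictMono.orderIsoOfSurjective w hm w.surjective) (OrderIso.refl _)
  ext a
  have h2 := congrArg (fun e => ((e a : Fin (n+1)) : ℕ)) this
  simpa using h2

lemma exists_word (n : ℕ) : ∀ (m : ℕ) (w : Equiv.Perm (Fin n)), (invSet n w).card ≤ m →
    ∃ l, IsAdjWord n l ∧ l.length ≤ (invSet n w).card ∧ l.prod = w := by
  intro m
  induction m with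
  | zero =>
    intro w hw
    refine ⟨[], by simp [IsAdjWord], by simp, ?_⟩
    simp only [List.prod_nil]
    symm
    apply perm_eq_one
    intro i h
    by_contra hc
    have hne : w ⟨i, Nat.lt_of_succ_lt h⟩ ≠ w ⟨i + 1, h⟩ := by
      simp [Fin.ext_iff]
    have := inv_lt n i h w (lt_of_le_of_ne (not_lt.mp hc) hne.symm)
    omega
  | succ m ih =>
    intro w hw
    by_cases hd : ∀ i (h : i + 1 < n), w ⟨i, Nat.lt_of_succ_lt h⟩ < w ⟨i + 1, h⟩
    · refine ⟨[], by simp [IsAdjWord], by simp, ?_⟩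
      simp only [List.prod_nil]
      exact (perm_eq_one n w hd).symm
    · push Not at hd
      obtain ⟨i, h, hc⟩ := hd
      have hne : w ⟨i, Nat.lt_of_succ_lt h⟩ ≠ w ⟨i + 1, h⟩ := by
        simp [Fin.ext_iff]
      have h1 := inv_lt n i h w (lt_of_le_of_ne hc hne.symm)
      obtain ⟨l, hl, hlen, hp⟩ := ih (w * adj n i h) (by omega)
      refine ⟨l ++ [adj n i h], ?_, by simp; omega, by simp [hp, mul_assoc]⟩
      intro x hx
      rcases List.mem_append.mp hx with hx | hx
      · exact hl x hx
      · exact ⟨i, h, by simpa using hx⟩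

lemma permLength_eq (n : ℕ) (w : Equiv.Perm (Fin n)) : permLength n w = (invSet n w).card := by
  obtain ⟨l, hl, hlen, hp⟩ := exists_word n _ w le_rfl
  have hle := inv_le_word n l hl
  rw [hp] at hle
  apply le_antisymm
  · exact Nat.sInf_le ⟨l, hl, le_antisymm hlen hle, hp⟩
  · have hne : {k | ∃ l : List (Equiv.Perm (Fin n)), IsAdjWord n l ∧ l.length = k ∧
        l.prod = w}.Nonempty := ⟨_, l, hl, rfl, hp⟩
    obtain ⟨l', hl', hlen', hp'⟩ := Nat.sInf_mem hne
    have := inv_le_word n l' hl'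
    rw [hp'] at this
    unfold permLength
    omega

lemma exists_reduced (n : ℕ) (w : Equiv.Perm (Fin n)) :
    ∃ l, IsAdjWord n l ∧ l.prod = w ∧ l.length = permLength n w := by
  obtain ⟨l, hl, hlen, hp⟩ := exists_word n _ w le_rfl
  have hle := inv_le_word n l hl
  rw [hp] at hle
  exact ⟨l, hl, hp, by rw [permLength_eq]; omega⟩

lemma permLength_le (n : ℕ) (l) (hl : IsAdjWord n l) : permLength n l.prod ≤ l.length :=
  Nat.sInf_le ⟨l, hl, rfl, rfl⟩

lemma word_sub {n : ℕ} {l l' : List (Equiv.Perm (Fin n))} (h : l'.Sublist l)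
    (hl : IsAdjWord n l) : IsAdjWord n l' := fun x hx => hl x (h.subset hx)

/-- strong exchange -/
lemma exchange (n : ℕ) (a b : Fin n) (hab : a < b) :
    ∀ (l : List (Equiv.Perm (Fin n))), IsAdjWord n l → l.prod b < l.prod a →
    ∃ l' : List (Equiv.Perm (Fin n)), l'.Sublist l ∧ l'.length + 1 = l.length ∧
      l'.prod = l.prod * Equiv.swap a b := by
  intro l
  induction l with
  | nil =>
    intro _ h
    simp only [List.prod_nil, Equiv.Perm.one_apply] at h
    exact absurd h (not_lt.mpr hab.le)
  | cons s t ih =>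
    intro hl h
    have ht : IsAdjWord n t := fun x hx => hl x (by simp [hx])
    by_cases hc : t.prod b < t.prod a
    · obtain ⟨l', h1, h2, h3⟩ := ih ht hc
      exact ⟨s :: l', h1.cons_cons s, by simp [h2], by simp [h3, mul_assoc]⟩
    · obtain ⟨i, hi, rfl⟩ := hl s (by simp)
      have hlt : t.prod a < t.prod b := by
        refine lt_of_le_of_ne (not_lt.mp hc) ?_
        simpa using hab.ne
      have key : ((t.prod a : Fin n) : ℕ) = i ∧ ((t.prod b : Fin n) : ℕ) = i + 1 := by
        by_contra hk
        have := swap_lt_iff n i hi _ _ hlt hk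
        simp only [List.prod_cons, Equiv.Perm.mul_apply] at h
        exact absurd h (not_lt.mpr this.le)
      refine ⟨t, List.sublist_cons_self _ _, by simp, ?_⟩
      have e1 : (⟨i, Nat.lt_of_succ_lt hi⟩ : Fin n) = t.prod a := Fin.ext key.1.symm
      have e2 : (⟨i + 1, hi⟩ : Fin n) = t.prod b := Fin.ext key.2.symm
      rw [List.prod_cons, e1, e2, Equiv.swap_apply_apply]
      simp [mul_assoc]

/-- every word contains a reduced subword for the same element -/
lemma exists_reduced_sub (n : ℕ) : ∀ (m : ℕ) (l : List (Equiv.Perm (Fin n))), l.length ≤ m →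
    IsAdjWord n l →
    ∃ l' : List (Equiv.Perm (Fin n)), l'.Sublist l ∧ l'.prod = l.prod ∧
      l'.length = permLength n l.prod := by
  intro m l hm hl
  clear hm
  induction l using List.reverseRecOn with
  | nil =>
    refine ⟨[], by simp, rfl, ?_⟩
    have := permLength_le n [] hl
    simp only [List.length_nil] at this ⊢
    omega
  | append_singleton l s ih =>
    have hl0 : IsAdjWord n l := fun x hx => hl x (by simp [hx])
    obtain ⟨l1, h1, h2, h3⟩ := ih hl0
    have hl1 := word_sub h1 hl0
    obtain ⟨i, h, rfl⟩ := hl s (by simp)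
    by_cases hd : l1.prod ⟨i + 1, h⟩ < l1.prod ⟨i, Nat.lt_of_succ_lt h⟩
    · obtain ⟨l2, g1, g2, g3⟩ := exchange n _ _ (by simp [Fin.lt_def]) l1 hl1 hd
      refine ⟨l2, (g1.trans h1).trans (List.sublist_append_left _ _), ?_, ?_⟩
      · rw [g3, h2]; simp
      · have e := inv_le_succ n i h l2.prod
        have e2 : l2.prod * adj n i h = l.prod := by rw [g3, h2]; simp [mul_assoc]
        have e3 : (l ++ [adj n i h]).prod = l2.prod := by rw [g3, h2]; simp
        change l2.length = permLength n (l ++ [adj n i h]).prod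
        rw [e3]
        have e4 := permLength_le n l2 (word_sub g1 hl1)
        rw [e2] at e
        rw [permLength_eq] at h3 e4 ⊢
        omega
    · refine ⟨l1 ++ [adj n i h], h1.append (List.Sublist.refl _), by simp [h2], ?_⟩
      have hne : l1.prod ⟨i, Nat.lt_of_succ_lt h⟩ ≠ l1.prod ⟨i + 1, h⟩ := by
        simp [Fin.ext_iff]
      have hlt := lt_of_le_of_ne (not_lt.mp hd) hne
      have e := inv_lt n i h (l1.prod * adj n i h) (by simpa using hlt)
      have e0 := inv_le_succ n i h l1.prod
      have e2 : l1.prod * adj n i h * adj n i h = l.prod := by rw [h2]; simp [mul_assoc]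
      rw [e2] at e
      have e3 : (l ++ [adj n i h]).prod = l1.prod * adj n i h := by rw [h2]; simp
      change _ = permLength n (l ++ [adj n i h]).prod
      rw [e3]
      rw [permLength_eq] at h3 ⊢
      simp only [List.length_append, List.length_singleton]
      rw [h2] at e0 e ⊢
      omega

/-- auxiliary subword relation -/
def SubRel (n : ℕ) (x' x : Equiv.Perm (Fin n)) : Prop :=
  ∀ l, IsAdjWord n l → l.prod = x → ∃ l' : List (Equiv.Perm (Fin n)), l'.Sublist l ∧ l'.prod = x'

lemma SubRel.trans {n : ℕ} {x y z : Equiv.Perm (Fin n)} (h1 : SubRel n x y) (h2 : SubRel n y z) :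
    SubRel n x z := by
  intro l hl hp
  obtain ⟨l', a, b⟩ := h2 l hl hp
  obtain ⟨l'', c, d⟩ := h1 l' (word_sub a hl) b
  exact ⟨l'', c.trans a, d⟩

lemma SubRel.refl {n : ℕ} (x : Equiv.Perm (Fin n)) : SubRel n x x :=
  fun l _ hp => ⟨l, List.Sublist.refl _, hp⟩

lemma SubRel.swap {n : ℕ} (x : Equiv.Perm (Fin n)) (a b : Fin n) (hab : a < b) (h : x b < x a) :
    SubRel n (x * Equiv.swap a b) x := by
  intro l hl hp
  obtain ⟨l', h1, _, h3⟩ := exchange n a b hab l hl (by rw [hp]; exact h)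
  exact ⟨l', h1, by rw [h3, hp]⟩

lemma SubRel.bruhat {n : ℕ} {x y : Equiv.Perm (Fin n)} (h : SubRel n x y) :
    permBruhatLE n x y := by
  obtain ⟨l, hl, hp, hlen⟩ := exists_reduced n y
  obtain ⟨l', h1, h2⟩ := h l hl hp
  obtain ⟨l'', g1, g2, g3⟩ := exists_reduced_sub n _ l' le_rfl (word_sub h1 hl)
  exact ⟨l, hl, hp, hlen, l'', g1.trans h1, by rw [g2, h2], by rw [g3, h2]⟩

lemma bruhat_length {n : ℕ} {x y : Equiv.Perm (Fin n)} (h : permBruhatLE n x y) :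
    permLength n x ≤ permLength n y := by
  obtain ⟨l, _, _, hlen, l', h1, _, h3⟩ := h
  rw [← hlen, ← h3]
  exact h1.length_le

lemma sub_bound (n : ℕ) (i : ℕ) : ∀ (l : List (Equiv.Perm (Fin n))), IsAdjWord n l →
    l.length = permLength n l.prod → ∀ l' : List (Equiv.Perm (Fin n)), l'.Sublist l →
    ∀ j : ℕ, (∀ a : Fin n, (a : ℕ) < i → ((l.prod a : Fin n) : ℕ) < j) →
    ∀ a : Fin n, (a : ℕ) < i → ((l'.prod a : Fin n) : ℕ) < j := by
  intro l
  induction l with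
  | nil =>
    intro _ _ l' hs j h a ha
    rw [List.sublist_nil.mp hs]
    exact h a ha
  | cons s t ih =>
    intro hl hred l' hs j h a ha
    have ht : IsAdjWord n t := fun x hx => hl x (by simp [hx])
    obtain ⟨m, hm, rfl⟩ := hl s (by simp)
    have htl := permLength_le n t ht
    have htred : t.length = permLength n t.prod := by
      obtain ⟨r, hr, hrp, hrl⟩ := exists_reduced n t.prod
      have hr' : IsAdjWord n (adj n m hm :: r) := by
        intro x hx
        rcases List.mem_cons.mp hx with hx | hx
        · exact ⟨m, hm, hx⟩
        · exact hr x hx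
      have := permLength_le n _ hr'
      rw [List.prod_cons, hrp, List.length_cons, hrl] at this
      rw [List.prod_cons, List.length_cons] at hred
      simp only [adj] at this
      omega
    have hcase : (∃ t', t'.Sublist t ∧ (l' = t' ∨ l' = adj n m hm :: t')) := by
      cases hs with
      | cons _ h => exact ⟨l', h, Or.inl rfl⟩
      | cons_cons _ h => exact ⟨_, h, Or.inr rfl⟩
    obtain ⟨t', ht', hl'⟩ := hcase
    have hv := fun c : Fin n => swap_val n m hm c
    by_cases hj : j = m + 1
    · have hord : t.prod⁻¹ ⟨m, Nat.lt_of_succ_lt hm⟩ < t.prod⁻¹ ⟨m + 1, hm⟩ := by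
        by_contra hc
        have hne : t.prod⁻¹ ⟨m, Nat.lt_of_succ_lt hm⟩ ≠ t.prod⁻¹ ⟨m + 1, hm⟩ := by
          simp [Fin.ext_iff]
        have hlt := lt_of_le_of_ne (not_lt.mp hc) hne.symm
        obtain ⟨r, g1, g2, g3⟩ := exchange n _ _ hlt t ht (by simp [Fin.lt_def])
        have := permLength_le n r (word_sub g1 ht)
        rw [g3, Equiv.swap_comm, Equiv.swap_apply_apply] at this
        simp only [inv_inv, ← mul_assoc] at this
        simp only [mul_inv_cancel, one_mul] at this
        rw [List.prod_cons, List.length_cons] at hred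
        omega
      have hu : ∀ a : Fin n, (a : ℕ) < i → ((t.prod a : Fin n) : ℕ) < m := by
        have key : ∀ a : Fin n, (a : ℕ) < i → ((t.prod a : Fin n) : ℕ) ≠ m := by
          intro a ha he
          have := h a ha
          rw [List.prod_cons, Equiv.Perm.mul_apply, hv, if_pos he] at this
          omega
        intro a ha
        have h1 := h a ha
        rw [List.prod_cons, Equiv.Perm.mul_apply, hv] at h1
        have h2 := key a ha
        by_contra h3
        have h4 : ((t.prod a : Fin n) : ℕ) = m + 1 := by
          split_ifs at h1 <;> omega
        have h5 : t.prod⁻¹ ⟨m + 1, hm⟩ = a := by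
          rw [Equiv.Perm.inv_eq_iff_eq]; exact Fin.ext h4.symm
        rw [h5] at hord
        refine key (t.prod⁻¹ ⟨m, Nat.lt_of_succ_lt hm⟩) ?_ (by simp)
        rw [Fin.lt_def] at hord
        omega
      have := ih ht htred t' ht' m hu a ha
      rcases hl' with rfl | rfl
      · omega
      · rw [List.prod_cons, Equiv.Perm.mul_apply, hv]
        split_ifs <;> omega
    · have hu : ∀ a : Fin n, (a : ℕ) < i → ((t.prod a : Fin n) : ℕ) < j := by
        intro a ha
        have := h a ha
        rw [List.prod_cons, Equiv.Perm.mul_apply, hv] at this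
        split_ifs at this <;> omega
      have := ih ht htred t' ht' j hu a ha
      rcases hl' with rfl | rfl
      · omega
      · rw [List.prod_cons, Equiv.Perm.mul_apply, hv]
        split_ifs <;> omega

lemma bruhat_bound {n : ℕ} {x' x : Equiv.Perm (Fin n)} (h : permBruhatLE n x' x) (i j : ℕ)
    (hb : ∀ a : Fin n, (a : ℕ) < i → ((x a : Fin n) : ℕ) < j) :
    ∀ a : Fin n, (a : ℕ) < i → ((x' a : Fin n) : ℕ) < j := by
  obtain ⟨l, hl, rfl, hlen, l', h1, rfl, _⟩ := h
  exact sub_bound n i l hl hlen l' h1 j hb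

/-- ordered pairs whose relative order (with respect to `g`) is preserved by `z` -/
def nonSet (n : ℕ) (g : Fin n → ℕ) (z : Equiv.Perm (Fin n)) : Finset (Fin n × Fin n) :=
  Finset.univ.filter (fun p => p.1 ≠ p.2 ∧ (g p.1 < g p.2 ↔ g (z p.1) < g (z p.2)))

lemma mem_nonSet {n : ℕ} {g : Fin n → ℕ} {z : Equiv.Perm (Fin n)} {p : Fin n × Fin n} :
    p ∈ nonSet n g z ↔ p.1 ≠ p.2 ∧ (g p.1 < g p.2 ↔ g (z p.1) < g (z p.2)) := by
  simp [nonSet]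

abbrev cnt (n : ℕ) (z : Equiv.Perm (Fin n)) : ℕ := (nonSet n (fun a => (a : ℕ)) z).card

lemma cnt_eq (n : ℕ) (x : Equiv.Perm (Fin n)) :
    cnt n (x * Fin.revPerm) = 2 * permLength n x := by
  rw [permLength_eq, two_mul]
  have h1 : Function.Injective (fun p : Fin n × Fin n => (Fin.rev p.2, Fin.rev p.1)) := by
    rintro ⟨a, b⟩ ⟨c, d⟩ h
    simp only [Prod.mk.injEq, Fin.rev_inj] at h
    exact Prod.ext h.2 h.1
  have h2 : Function.Injective (fun p : Fin n × Fin n => (Fin.rev p.1, Fin.rev p.2)) := by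
    rintro ⟨a, b⟩ ⟨c, d⟩ h
    simp only [Prod.mk.injEq, Fin.rev_inj] at h
    exact Prod.ext h.1 h.2
  have e : nonSet n (fun a => (a : ℕ)) (x * Fin.revPerm) =
      (invSet n x).image (fun p : Fin n × Fin n => (Fin.rev p.2, Fin.rev p.1)) ∪
      (invSet n x).image (fun p : Fin n × Fin n => (Fin.rev p.1, Fin.rev p.2)) := by
    ext ⟨a, b⟩
    simp only [mem_nonSet, Finset.mem_union, Finset.mem_image, mem_invSet, Prod.exists,
      Prod.mk.injEq, Equiv.Perm.mul_apply, Fin.revPerm_apply]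
    constructor
    · rintro ⟨h, h'⟩
      have hne : x (Fin.rev a) ≠ x (Fin.rev b) := by simpa using h
      rcases lt_or_gt_of_ne h with hlt | hgt
      · left
        refine ⟨Fin.rev b, Fin.rev a, ⟨by simpa using hlt, ?_⟩, by simp, by simp⟩
        exact h'.mp hlt
      · right
        refine ⟨Fin.rev a, Fin.rev b, ⟨by simpa using hgt, ?_⟩, by simp, by simp⟩
        have : ¬ (x (Fin.rev a) < x (Fin.rev b)) := fun hh =>
          absurd (h'.mpr hh) (not_lt.mpr hgt.le)
        exact lt_of_le_of_ne (not_lt.mp this) hne.symm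
    · rintro (⟨c, d, ⟨h, h'⟩, rfl, rfl⟩ | ⟨c, d, ⟨h, h'⟩, rfl, rfl⟩)
      · refine ⟨by simpa using h.ne', ?_⟩
        simp only [Fin.rev_rev]
        exact iff_of_true (by simpa [Fin.lt_def] using (Fin.rev_lt_rev.mpr h)) h'
      · refine ⟨by simpa using h.ne, ?_⟩
        simp only [Fin.rev_rev]
        refine iff_of_false (not_lt.mpr ?_) (not_lt.mpr h'.le)
        exact (Fin.rev_lt_rev.mpr h).le
  unfold cnt
  rw [e, Finset.card_union_of_disjoint, Finset.card_image_of_injective _ h1,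
    Finset.card_image_of_injective _ h2]
  rw [Finset.disjoint_left]
  rintro ⟨a, b⟩ ha hb
  simp only [Finset.mem_image, mem_invSet, Prod.exists, Prod.mk.injEq] at ha hb
  obtain ⟨c, d, ⟨h, _⟩, rfl, rfl⟩ := ha
  obtain ⟨c', d', ⟨h', _⟩, e1, e2⟩ := hb
  rw [Fin.rev_inj] at e1 e2
  subst e1; subst e2
  exact absurd h (not_lt.mpr h'.le)

def Good (n : ℕ) (z : Equiv.Perm (Fin n)) : Prop :=
  ∀ a b : Fin n, a < b → (z a ≠ a ∨ z b ≠ b) → ¬ (z a < z b ∧ z (z a) < z (z b))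

def ff (n : ℕ) (z : Equiv.Perm (Fin n)) (p : Fin n × Fin n) : ℕ :=
  if p.1 ≠ p.2 ∧ (p.1 < p.2 ↔ z p.1 < z p.2) then 1 else 0

def TT (n : ℕ) (z : Equiv.Perm (Fin n)) (p : Fin n × Fin n) : ℕ :=
  ff n z p + ff n z (z p.1, z p.2) + ff n z (z (z p.1), z (z p.2))

def LL (n : ℕ) (z : Equiv.Perm (Fin n)) (p : Fin n × Fin n) : ℕ :=
  (if p.1 ≠ p.2 then 1 else 0) + 2 * (if p.1 ≠ p.2 ∧ (z p.1 = p.1 ∧ z p.2 = p.2) then 1 else 0)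

lemma sum_TT (n : ℕ) (z : Equiv.Perm (Fin n)) : ∑ p, TT n z p = 3 * cnt n z := by
  have h0 : cnt n z = ∑ p, ff n z p := by
    simp only [cnt, nonSet, ff, Finset.card_filter, Fin.lt_def]
  have h1 : ∑ p : Fin n × Fin n, ff n z (z p.1, z p.2) = ∑ p, ff n z p :=
    Equiv.sum_comp (Equiv.prodCongr z z) (ff n z)
  have h2 : ∑ p : Fin n × Fin n, ff n z (z (z p.1), z (z p.2)) = ∑ p, ff n z p :=
    Equiv.sum_comp (Equiv.prodCongr (z * z) (z * z)) (ff n z)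
  simp only [TT, Finset.sum_add_distrib, h1, h2, h0]
  ring

def fixS (n : ℕ) (z : Equiv.Perm (Fin n)) : Finset (Fin n) := Finset.univ.filter (fun a => z a = a)

lemma mem_fixS {n : ℕ} {z : Equiv.Perm (Fin n)} {a : Fin n} : a ∈ fixS n z ↔ z a = a := by
  simp [fixS]

lemma sum_LL (n : ℕ) (z : Equiv.Perm (Fin n)) :
    ∑ p, LL n z p = (n * n - n) + 2 * ((fixS n z).card * (fixS n z).card - (fixS n z).card) := by
  simp only [LL, Finset.sum_add_distrib, ← Finset.mul_sum, ← Finset.card_filter]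
  rw [← Finset.offDiag_card (fixS n z)]
  have h1 : (Finset.univ.filter (fun p : Fin n × Fin n => p.1 ≠ p.2)) =
      (Finset.univ : Finset (Fin n)).offDiag := by
    ext p; simp
  have h2 : (Finset.univ.filter (fun p : Fin n × Fin n => p.1 ≠ p.2 ∧
      (z p.1 = p.1 ∧ z p.2 = p.2))) = (fixS n z).offDiag := by
    ext p; simp [mem_fixS]; tauto
  rw [h1, h2, Finset.offDiag_card]
  simp

lemma LL_le_TT (n : ℕ) (z : Equiv.Perm (Fin n)) (hz : ∀ a, z (z (z a)) = a) (p) :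
    LL n z p ≤ TT n z p := by
  obtain ⟨a, b⟩ := p
  by_cases hab : a = b
  · simp [LL, hab]
  have hab1 : z a ≠ z b := by simpa using hab
  have hab2 : z (z a) ≠ z (z b) := by simpa using hab
  by_cases hf : z a = a ∧ z b = b
  · simp [LL, TT, ff, hab, hf.1, hf.2]
  simp only [LL, TT, ff, hz, hf, ne_eq, hab, hab1, hab2]
  simp only [not_false_eq_true, true_and, and_false, if_true, if_false]
  split_ifs <;> omega

lemma TT_le_LL (n : ℕ) (z : Equiv.Perm (Fin n)) (hz : ∀ a, z (z (z a)) = a) (hg : Good n z) (p) :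
    TT n z p ≤ LL n z p := by
  obtain ⟨a, b⟩ := p
  by_cases hab : a = b
  · simp [TT, ff, hab]
  have hab1 : z a ≠ z b := by simpa using hab
  have hab2 : z (z a) ≠ z (z b) := by simpa using hab
  by_cases hf : z a = a ∧ z b = b
  · simp [LL, TT, ff, hab, hf.1, hf.2]
  have g1 := hg a b
  have g2 := hg b a
  simp only [LL, TT, ff, hz, hf, ne_eq, hab, hab1, hab2]
  simp only [not_false_eq_true, true_and, and_false, if_true, if_false]
  have l1 := lt_or_gt_of_ne hab
  have l2 := lt_or_gt_of_ne hab1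
  have l3 := lt_or_gt_of_ne hab2
  have m1 := @lt_asymm _ _ a b
  have m2 := @lt_asymm _ _ (z a) (z b)
  have m3 := @lt_asymm _ _ (z (z a)) (z (z b))
  have hf' : z a ≠ a ∨ z b ≠ b := by
    by_contra hc
    push Not at hc
    exact hf hc
  have g3 := fun h => g1 h hf'
  have g4 := fun h => g2 h hf'.symm
  clear g1 g2 hz hg
  rcases l1 with l1 | l1 <;> rcases l2 with l2 | l2 <;> rcases l3 with l3 | l3 <;>
    simp_all [not_lt.mpr l1.le, not_lt.mpr l2.le, not_lt.mpr l3.le]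

lemma good_of_eq (n : ℕ) (z : Equiv.Perm (Fin n)) (hz : ∀ a, z (z (z a)) = a)
    (h : ∀ p, TT n z p = LL n z p) : Good n z := by
  rintro a b hab hf ⟨h1, h2⟩
  have hh := h (a, b)
  have hf' : ¬ (z a = a ∧ z b = b) := by tauto
  simp [LL, TT, ff, hz, hf', hab, h1, h2, hab.ne] at hh

lemma cnt_ge (n : ℕ) (z : Equiv.Perm (Fin n)) (hz : ∀ a, z (z (z a)) = a) :
    (n * n - n) + 2 * ((fixS n z).card * (fixS n z).card - (fixS n z).card) ≤ 3 * cnt n z := by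
  rw [← sum_TT, ← sum_LL]
  exact Finset.sum_le_sum (fun p _ => LL_le_TT n z hz p)

lemma cnt_good (n : ℕ) (z : Equiv.Perm (Fin n)) (hz : ∀ a, z (z (z a)) = a) (hg : Good n z) :
    3 * cnt n z =
    (n * n - n) + 2 * ((fixS n z).card * (fixS n z).card - (fixS n z).card) := by
  rw [← sum_TT, ← sum_LL]
  exact Finset.sum_congr rfl (fun p _ => le_antisymm (TT_le_LL n z hz hg p) (LL_le_TT n z hz p))

lemma good_of_cnt (n : ℕ) (z : Equiv.Perm (Fin n)) (hz : ∀ a, z (z (z a)) = a)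
    (h : 3 * cnt n z =
    (n * n - n) + 2 * ((fixS n z).card * (fixS n z).card - (fixS n z).card)) : Good n z := by
  rw [← sum_TT, ← sum_LL] at h
  apply good_of_eq n z hz
  have := (Finset.sum_eq_sum_iff_of_le (fun p _ => LL_le_TT n z hz p)).mp h.symm
  exact fun p => (this p (Finset.mem_univ p)).symm

/-- elements of the class of `(3^k,1^{n-3k})` -/
def Typ (n k : ℕ) (z : Equiv.Perm (Fin n)) : Prop :=
  (∀ a, z (z (z a)) = a) ∧ (fixS n z).card + 3 * k = n

lemma step (n k : ℕ) (z : Equiv.Perm (Fin n)) (ht : Typ n k z) (hg : Good n z)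
    (hk : 3 * (k + 1) ≤ n) :
    ∃ z', Typ n (k + 1) z' ∧ Good n z' ∧ SubRel n (z' * Fin.revPerm) (z * Fin.revPerm) := by
  obtain ⟨hz, hc⟩ := ht
  have hne : (fixS n z).Nonempty := by
    rw [← Finset.card_pos]; omega
  obtain ⟨f1, hf1, hmin⟩ : ∃ f1, z f1 = f1 ∧ ∀ d, z d = d → f1 ≤ d :=
    ⟨(fixS n z).min' hne, mem_fixS.mp (Finset.min'_mem _ _),
      fun d hd => Finset.min'_le _ _ (mem_fixS.mpr hd)⟩
  obtain ⟨f3, hf3, hmax⟩ : ∃ f1, z f1 = f1 ∧ ∀ d, z d = d → d ≤ f1 :=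
    ⟨(fixS n z).max' hne, mem_fixS.mp (Finset.max'_mem _ _),
      fun d hd => Finset.le_max' _ _ (mem_fixS.mpr hd)⟩
  obtain ⟨f2, hf2⟩ : (fixS n z \ {f1, f3}).Nonempty := by
    rw [← Finset.card_pos]
    have h1 := Finset.le_card_sdiff {f1, f3} (fixS n z)
    have h2 := Finset.card_le_two (a := f1) (b := f3)
    omega
  simp only [Finset.mem_sdiff, mem_fixS, Finset.mem_insert, Finset.mem_singleton, not_or] at hf2
  obtain ⟨hf2, h21, h23⟩ := hf2
  have l12 : f1 < f2 := lt_of_le_of_ne (hmin _ hf2) (Ne.symm h21)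
  have l23 : f2 < f3 := lt_of_le_of_ne (hmax _ hf2) h23
  have l13 := l12.trans l23
  set c : Equiv.Perm (Fin n) := Equiv.swap f1 f2 * Equiv.swap f2 f3 with hcdef
  have c1 : c f1 = f2 := by
    simp only [hcdef, Equiv.Perm.mul_apply]
    rw [Equiv.swap_apply_of_ne_of_ne l12.ne l13.ne, Equiv.swap_apply_left]
  have c2 : c f2 = f3 := by
    simp only [hcdef, Equiv.Perm.mul_apply, Equiv.swap_apply_left]
    rw [Equiv.swap_apply_of_ne_of_ne l13.ne' l23.ne']
  have c3 : c f3 = f1 := by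
    simp [hcdef, Equiv.Perm.mul_apply]
  have c0 : ∀ a, a ≠ f1 → a ≠ f2 → a ≠ f3 → c a = a := by
    intro a h1 h2 h3
    simp only [hcdef, Equiv.Perm.mul_apply]
    rw [Equiv.swap_apply_of_ne_of_ne h2 h3, Equiv.swap_apply_of_ne_of_ne h1 h2]
  have y1 : (z * c) f1 = f2 := by rw [Equiv.Perm.mul_apply, c1, hf2]
  have y2 : (z * c) f2 = f3 := by rw [Equiv.Perm.mul_apply, c2, hf3]
  have y3 : (z * c) f3 = f1 := by rw [Equiv.Perm.mul_apply, c3, hf1]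
  have y0 : ∀ a, a ≠ f1 → a ≠ f2 → a ≠ f3 → (z * c) a = z a := by
    intro a h1 h2 h3
    rw [Equiv.Perm.mul_apply, c0 a h1 h2 h3]
  have zne : ∀ d, z d = d → ∀ a, a ≠ d → z a ≠ d := by
    intro d hd a ha h
    exact ha (z.injective (h.trans hd.symm))
  have y00 : ∀ a, a ≠ f1 → a ≠ f2 → a ≠ f3 → (z * c) ((z * c) a) = z (z a) := by
    intro a h1 h2 h3
    rw [y0 a h1 h2 h3, y0 _ (zne _ hf1 a h1) (zne _ hf2 a h2) (zne _ hf3 a h3)]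
  -- a fixed point lies strictly inside the orbit of a nonfixed point
  have inside : ∀ d b, z d = d → z b ≠ b →
      (b < d ∨ z b < d ∨ z (z b) < d) ∧ (d < b ∨ d < z b ∨ d < z (z b)) := by
    intro d b hd hb
    have g1 := hg d b
    have g2 := hg b d
    rw [hd, hd] at g1 g2
    have n1 : b ≠ d := fun h => hb (h ▸ hd)
    have n2 := zne d hd b n1
    have n3 := zne d hd _ n2
    have g1' := fun h => g1 h (Or.inr hb)
    have g2' := fun h => g2 h (Or.inl hb)
    clear g1 g2
    constructor
    · by_contra hc
      push Not at hc
      exact g1' (lt_of_le_of_ne hc.1 n1.symm)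
        ⟨lt_of_le_of_ne hc.2.1 n2.symm, lt_of_le_of_ne hc.2.2 n3.symm⟩
    · by_contra hc
      push Not at hc
      exact g2' (lt_of_le_of_ne hc.1 n1)
        ⟨lt_of_le_of_ne hc.2.1 n2, lt_of_le_of_ne hc.2.2 n3⟩
  generalize hy : z * c = y at *
  refine ⟨y, ⟨?_, ?_⟩, ?_, ?_⟩
  · intro a
    by_cases h1 : a = f1
    · rw [h1, y1, y2, y3]
    by_cases h2 : a = f2
    · rw [h2, y2, y3, y1]
    by_cases h3 : a = f3
    · rw [h3, y3, y1, y2]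
    rw [y00 a h1 h2 h3, y0 _ (zne _ hf1 _ (zne _ hf1 a h1)) (zne _ hf2 _ (zne _ hf2 a h2))
      (zne _ hf3 _ (zne _ hf3 a h3)), hz]
  · have e : fixS n z = insert f1 (insert f2 (insert f3 (fixS n y))) := by
      ext a
      simp only [Finset.mem_insert, mem_fixS]
      by_cases h1 : a = f1
      · simp [h1, hf1]
      by_cases h2 : a = f2
      · simp [h2, hf2]
      by_cases h3 : a = f3
      · simp [h3, hf3]
      rw [y0 a h1 h2 h3]; tauto
    have n3 : f3 ∉ fixS n y := by rw [mem_fixS, y3]; exact l13.ne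
    have n2 : f2 ∉ insert f3 (fixS n y) := by
      rw [Finset.mem_insert, mem_fixS, y2]; push Not; exact ⟨l23.ne, l23.ne'⟩
    have n1 : f1 ∉ insert f2 (insert f3 (fixS n y)) := by
      rw [Finset.mem_insert, Finset.mem_insert, mem_fixS, y1]; push Not
      exact ⟨l12.ne, l13.ne, l12.ne'⟩
    rw [e, Finset.card_insert_of_notMem n1, Finset.card_insert_of_notMem n2,
      Finset.card_insert_of_notMem n3] at hc
    omega
  · have mix : ∀ f b, (f = f1 ∨ f = f2 ∨ f = f3) → (b ≠ f1 ∧ b ≠ f2 ∧ b ≠ f3) →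
        ¬ (f < b ∧ y f < y b ∧ y (y f) < y (y b)) ∧ ¬ (b < f ∧ y b < y f ∧ y (y b) < y (y f)) := by
      intro f b hf hb
      have hin : (b < f1 ∨ z b < f1 ∨ z (z b) < f1) ∧ (f3 < b ∨ f3 < z b ∨ f3 < z (z b))
          ∨ (f1 ≤ b ∧ b ≤ f3 ∧ z b = b) := by
        by_cases h : z b = b
        · exact Or.inr ⟨hmin _ h, hmax _ h, h⟩
        · exact Or.inl ⟨(inside f1 b hf1 h).1, (inside f3 b hf3 h).2⟩
      rw [y00 b hb.1 hb.2.1 hb.2.2, y0 b hb.1 hb.2.1 hb.2.2]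
      have e : ∀ w, (f = f1 ∧ y f = f2 ∧ y (y f) = f3) ∨ (f = f2 ∧ y f = f3 ∧ y (y f) = f1) ∨
          (f = f3 ∧ y f = f1 ∧ y (y f) = f2) ∨ w := by
        intro w
        rcases hf with rfl | rfl | rfl
        · simp [y1, y2]
        · simp [y2, y3]
        · simp [y1, y3]
      rcases e False with ⟨e1, e2, e3⟩ | ⟨e1, e2, e3⟩ | ⟨e1, e2, e3⟩ | h
      all_goals try exact h.elim
      all_goals
        rw [e3, e2, e1]
        rcases hin with hin | ⟨i1, i2, i3⟩
        · constructor <;> (rintro ⟨q1, q2, q3⟩; omega)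
        · rw [i3, i3]
          constructor <;> (rintro ⟨q1, q2, q3⟩; omega)
    rintro a b hab hfix ⟨h1, h2⟩
    by_cases ha : a = f1 ∨ a = f2 ∨ a = f3
    · by_cases hb : b = f1 ∨ b = f2 ∨ b = f3
      · rcases ha with rfl | rfl | rfl <;> rcases hb with rfl | rfl | rfl <;>
          simp only [y1, y2, y3] at h1 h2 <;> omega
      · push Not at hb
        exact (mix a b ha hb).1 ⟨hab, h1, h2⟩
    · push Not at ha
      by_cases hb : b = f1 ∨ b = f2 ∨ b = f3
      · exact (mix b a hb ha).2 ⟨hab, h1, h2⟩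
      · push Not at hb
        rw [y0 a ha.1 ha.2.1 ha.2.2, y0 b hb.1 hb.2.1 hb.2.2] at hfix h1
        rw [y00 a ha.1 ha.2.1 ha.2.2, y00 b hb.1 hb.2.1 hb.2.2] at h2
        exact hg a b hab hfix ⟨h1, h2⟩
  · have s1 := SubRel.swap (z * Fin.revPerm) (Fin.rev f2) (Fin.rev f1)
      (Fin.rev_lt_rev.mpr l12) (by simpa [hf1, hf2] using l12)
    have s2 := SubRel.swap (z * Fin.revPerm * Equiv.swap (Fin.rev f2) (Fin.rev f1)) (Fin.rev f3)
      (Fin.rev f2) (Fin.rev_lt_rev.mpr l23) (by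
        simp only [Equiv.Perm.mul_apply, Equiv.swap_apply_left]
        rw [Equiv.swap_apply_of_ne_of_ne (by simpa using l23.ne') (by simpa using l13.ne')]
        simpa [hf1, hf3] using l13)
    have e : y * Fin.revPerm = z * Fin.revPerm * Equiv.swap (Fin.rev f2) (Fin.rev f1) *
        Equiv.swap (Fin.rev f3) (Fin.rev f2) := by
      have r : ∀ a b : Fin n, Equiv.swap (Fin.rev a) (Fin.rev b) =
          Fin.revPerm * Equiv.swap a b * Fin.revPerm := by
        intro a b
        have := Equiv.swap_apply_apply (Fin.revPerm : Equiv.Perm (Fin n)) a b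
        have hi : (Fin.revPerm : Equiv.Perm (Fin n))⁻¹ = Fin.revPerm := rfl
        rw [hi] at this
        exact this
      have rr : (Fin.revPerm : Equiv.Perm (Fin n)) * Fin.revPerm = 1 := by
        ext; simp
      rw [← hy, r, r, hcdef, Equiv.swap_comm f2 f1, Equiv.swap_comm f3 f2]
      have key : ∀ (A R B C : Equiv.Perm (Fin n)), R * R = 1 →
          A * (B * C) * R = A * R * (R * B * R) * (R * C * R) := by
        intro A R B C h
        have : A * R * (R * B * R) * (R * C * R) = A * (R * R) * B * (R * R) * C * R := by group
        rw [this, h]; group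
      exact key _ _ _ _ rr
    rw [e]
    exact s2.trans s1

lemma steps (n k : ℕ) (z : Equiv.Perm (Fin n)) (ht : Typ n k z) (hg : Good n z) (m : ℕ) :
    3 * (k + m) ≤ n →
    ∃ z', Typ n (k + m) z' ∧ Good n z' ∧ SubRel n (z' * Fin.revPerm) (z * Fin.revPerm) := by
  induction m with
  | zero => exact fun _ => ⟨z, ht, hg, SubRel.refl _⟩
  | succ m ih =>
    intro h
    obtain ⟨z1, a, b, c⟩ := ih (by omega)
    obtain ⟨z2, a', b', c'⟩ := step n (k + m) z1 a b (by omega)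
    exact ⟨z2, a', b', c'.trans c⟩

lemma exists_good (n k : ℕ) (hk : 3 * k ≤ n) : ∃ z, Typ n k z ∧ Good n z := by
  obtain ⟨z, a, b, _⟩ := steps n 0 1 ⟨by simp, by simp [fixS]⟩
    (by intro a b _ h; simp at h) k (by omega)
  exact ⟨z, by simpa using a, b⟩

lemma typ_iff (n k : ℕ) (hk : 3 * k ≤ n) (z : Equiv.Perm (Fin n)) :
    fullCycleType n z = Multiset.replicate k 3 + Multiset.replicate (n - 3 * k) 1 ↔ Typ n k z := by
  have hfix : (fixS n z).card + z.cycleType.sum = n := by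
    rw [Equiv.Perm.sum_cycleType]
    have h := Finset.card_filter_add_card_filter_not (s := (Finset.univ : Finset (Fin n)))
      (fun a => z a = a)
    have e : z.support = Finset.univ.filter (fun a => ¬ z a = a) := by
      ext a; simp
    rw [e]
    simpa [fixS] using h
  constructor
  · intro h
    have hct : z.cycleType = Multiset.replicate k 3 := by
      have h1 := congrArg (Multiset.filter (fun a => 2 ≤ a)) h
      rw [fullCycleType, Multiset.filter_add, Multiset.filter_add] at h1
      rw [Multiset.filter_eq_self.mpr (fun a ha => Equiv.Perm.two_le_of_mem_cycleType ha)] at h1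
      have e1 : ∀ m, Multiset.filter (fun a => 2 ≤ a) (Multiset.replicate m 1) = 0 := by
        intro m
        rw [Multiset.filter_eq_nil]
        intro a ha
        rw [Multiset.eq_of_mem_replicate ha]; omega
      have e2 : Multiset.filter (fun a => 2 ≤ a) (Multiset.replicate k 3) =
          Multiset.replicate k 3 := by
        rw [Multiset.filter_eq_self]
        intro a ha
        rw [Multiset.eq_of_mem_replicate ha]; omega
      rw [e1, e1, e2] at h1
      simpa using h1
    refine ⟨?_, ?_⟩
    · have h3 : orderOf z ∣ 3 := by
        rw [← Equiv.Perm.lcm_cycleType, hct, Multiset.lcm_dvd]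
        intro b hb
        rw [Multiset.eq_of_mem_replicate hb]
      have := orderOf_dvd_iff_pow_eq_one.mp h3
      intro a
      have h4 := congrArg (fun w : Equiv.Perm (Fin n) => w a) this
      simpa [pow_succ] using h4
    · rw [hct] at hfix
      simp at hfix
      omega
  · rintro ⟨h1, h2⟩
    have hp : z ^ 3 = 1 := by
      ext a; simp [pow_succ, h1]
    have hall : ∀ b ∈ z.cycleType, b = 3 := by
      intro b hb
      have := (Equiv.Perm.dvd_of_mem_cycleType hb).trans (orderOf_dvd_of_pow_eq_one hp)
      have h4 := Equiv.Perm.two_le_of_mem_cycleType hb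
      rcases (Nat.dvd_prime Nat.prime_three).mp this with h | h <;> omega
    have hrep := Multiset.eq_replicate_card.mpr hall
    have hs : z.cycleType.sum = 3 * k := by omega
    have hcard : Multiset.card z.cycleType = k := by
      rw [hrep] at hs
      simp at hs
      omega
    rw [fullCycleType, hs]
    rw [hcard] at hrep
    rw [hrep]

lemma rev_mul (n : ℕ) (x : Equiv.Perm (Fin n)) : x * Fin.revPerm * Fin.revPerm = x := by
  ext a; simp

lemma minimal_iff (n k : ℕ) (hk : 3 * k ≤ n) (x : Equiv.Perm (Fin n)) :
    isMinimalIn n (Multiset.replicate k 3 + Multiset.replicate (n - 3 * k) 1) x ↔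
      Typ n k (x * Fin.revPerm) ∧ Good n (x * Fin.revPerm) := by
  unfold isMinimalIn inClass
  simp only [typ_iff n k hk]
  constructor
  · rintro ⟨ht, hmin⟩
    refine ⟨ht, good_of_cnt n _ ht.1 ?_⟩
    obtain ⟨z, hz, hg⟩ := exists_good n k hk
    have h1 := hmin (z * Fin.revPerm) (by rwa [rev_mul])
    have h2 := cnt_eq n x
    have h3 := cnt_eq n (z * Fin.revPerm)
    rw [rev_mul] at h3
    have h4 := cnt_good n z hz.1 hg
    have h5 := cnt_ge n _ ht.1
    have h6 : (fixS n z).card = (fixS n (x * Fin.revPerm)).card := by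
      have := hz.2; have := ht.2; omega
    rw [h6] at h4
    omega
  · rintro ⟨ht, hg⟩
    refine ⟨ht, fun z hz => ?_⟩
    have h2 := cnt_eq n x
    have h3 := cnt_eq n z
    have h4 := cnt_good n _ ht.1 hg
    have h5 := cnt_ge n _ hz.1
    have h6 : (fixS n (z * Fin.revPerm)).card = (fixS n (x * Fin.revPerm)).card := by
      have := hz.2; have := ht.2; omega
    rw [h6] at h5
    omega

lemma classLE_iff (n j k : ℕ) (hj : 3 * j ≤ n) (hk : 3 * k ≤ n) :
    classLE n (Multiset.replicate k 3 + Multiset.replicate (n - 3 * k) 1)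
      (Multiset.replicate j 3 + Multiset.replicate (n - 3 * j) 1) ↔ j ≤ k := by
  constructor
  · intro h
    by_contra hlt
    obtain ⟨z, hz, hg⟩ := exists_good n j hj
    obtain ⟨x', hx', hb⟩ := h (z * Fin.revPerm) ((minimal_iff n j hj _).mpr (by
      rw [rev_mul]; exact ⟨hz, hg⟩))
    rw [minimal_iff n k hk] at hx'
    have h1 := bruhat_length hb
    have h2 := cnt_eq n x'
    have h3 := cnt_eq n (z * Fin.revPerm)
    rw [rev_mul] at h3
    have h4 := cnt_good n _ hx'.1.1 hx'.2
    have h5 := cnt_good n _ hz.1 hg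
    have h6 := hx'.1.2
    have h7 := hz.2
    have h8 : (fixS n z).card + 3 ≤ (fixS n (x' * Fin.revPerm)).card := by omega
    generalize (fixS n z).card = F at *
    generalize (fixS n (x' * Fin.revPerm)).card = G at *
    have h9 : F * F - F < G * G - G := by
      obtain ⟨d, rfl⟩ := Nat.exists_eq_add_of_le h8
      have e1 : F * F - F + F = F * F := Nat.sub_add_cancel (Nat.le_mul_self F)
      have e2 := Nat.sub_add_cancel (Nat.le_mul_self (F + 3 + d))
      nlinarith
    omega
  · intro h x hx
    rw [minimal_iff n j hj] at hx
    obtain ⟨m, rfl⟩ := Nat.exists_eq_add_of_le h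
    obtain ⟨z', a, b, c⟩ := steps n j _ hx.1 hx.2 m hk
    refine ⟨z' * Fin.revPerm, ?_, ?_⟩
    · rw [minimal_iff n _ hk, rev_mul]; exact ⟨a, b⟩
    · rw [rev_mul] at c
      exact c.bruhat

lemma alt (s : ℕ → Prop) (m : ℕ) (h : ∀ i < m, ¬ (s i ↔ s (i + 1))) :
    (Even m → (s m ↔ s 0)) ∧ (Odd m → (s m ↔ ¬ s 0)) := by
  induction m with
  | zero => simp
  | succ m ih =>
    have h1 := ih (fun i hi => h i (by omega))
    have h2 := h m (by omega)
    rw [Nat.even_add_one, Nat.odd_add_one, Nat.not_even_iff_odd, Nat.not_odd_iff_even]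
    refine ⟨fun e => ?_, fun e => ?_⟩
    · have := h1.2 e; tauto
    · have := h1.1 e; tauto

lemma window (n : ℕ) (z : Equiv.Perm (Fin n)) (a b : Fin n) (hab : a ≠ b) (m : ℕ) (hm : Odd m)
    (h : a < b ↔ z^[m] a < z^[m] b) :
    ∃ i < m, (z^[i] a, z^[i] b) ∈ nonSet n (fun a => (a : ℕ)) z := by
  by_contra hc
  push Not at hc
  have := (alt (fun i => z^[i] a < z^[i] b) m (by
    intro i hi hh
    apply hc i hi
    rw [mem_nonSet]
    refine ⟨fun e => hab (z.injective.iterate i e), ?_⟩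
    simp only [Function.iterate_succ_apply'] at hh
    exact hh)).2 hm
  simp only [Function.iterate_zero, id_eq] at this
  tauto

/-- the orbit data of a chosen long odd cycle -/
structure OrbitData (n : ℕ) (z : Equiv.Perm (Fin n)) (p : ℕ) (c : ℕ → Fin n)
    (A : Finset (Fin n)) : Prop where
  hodd : Odd p
  hc : ∀ i, c i = z^[i] (c 0)
  hper : z^[p] (c 0) = c 0
  hinj : ∀ i j, i < p → j < p → c i = c j → i = j
  hA : ∀ x, x ∈ A ↔ ∃ i < p, c i = x
  hmin : ∀ x ∈ A, c 0 ≤ x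
  hper' : ∀ x, ∃ q, 0 < q ∧ q ≤ p ∧ Odd q ∧ z^[q] x = x ∧
    ∀ i j, i < q → j < q → z^[i] x = z^[j] x → i = j

namespace OrbitData
variable {n : ℕ} {z : Equiv.Perm (Fin n)} {p : ℕ} {c : ℕ → Fin n} {A : Finset (Fin n)}

lemma p_pos (H : OrbitData n z p c A) : 0 < p := H.hodd.pos

lemma c_succ (H : OrbitData n z p c A) (i : ℕ) : z (c i) = c (i + 1) := by
  rw [H.hc (i + 1), H.hc i, Function.iterate_succ_apply']

lemma c_iter (H : OrbitData n z p c A) (i j : ℕ) : z^[i] (c j) = c (i + j) := by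
  rw [H.hc (i + j), H.hc j, Function.iterate_add_apply]

lemma c_p (H : OrbitData n z p c A) : c p = c 0 := by rw [H.hc p, H.hper]

lemma c_add_p (H : OrbitData n z p c A) (i : ℕ) : c (i + p) = c i := by
  rw [← H.c_iter i p, H.c_p, ← H.hc]

lemma c_mod (H : OrbitData n z p c A) (i : ℕ) : c (i % p) = c i := by
  conv_rhs => rw [← Nat.mod_add_div i p]
  generalize i / p = k
  induction k with
  | zero => simp
  | succ k ih => rw [Nat.mul_succ, ← Nat.add_assoc, H.c_add_p, ih]

lemma c_mem (H : OrbitData n z p c A) (i : ℕ) : c i ∈ A := by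
  rw [H.hA]
  exact ⟨i % p, Nat.mod_lt _ H.p_pos, H.c_mod i⟩

lemma mem_iff (H : OrbitData n z p c A) (x : Fin n) : z x ∈ A ↔ x ∈ A := by
  constructor
  · intro h
    obtain ⟨i, hi, h⟩ := (H.hA _).mp h
    have : c (i + p) = z x := by rw [H.c_add_p, h]
    have e : i + p = (i + p - 1) + 1 := by have := H.p_pos; omega
    rw [e, ← H.c_succ] at this
    rw [← z.injective this]
    exact H.c_mem _
  · intro h
    obtain ⟨i, hi, rfl⟩ := (H.hA _).mp h
    rw [H.c_succ]; exact H.c_mem _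

lemma iter_mem_iff (H : OrbitData n z p c A) (i : ℕ) (x : Fin n) : z^[i] x ∈ A ↔ x ∈ A := by
  induction i with
  | zero => simp
  | succ i ih => rw [Function.iterate_succ_apply', H.mem_iff, ih]

lemma card_A (H : OrbitData n z p c A) : A.card = p := by
  have : A = (Finset.range p).image c := by
    ext x; rw [H.hA]; simp
  rw [this, Finset.card_image_of_injOn, Finset.card_range]
  intro i hi j hj h
  exact H.hinj i j (by simpa using hi) (by simpa using hj) h

lemma lower_AA (H : OrbitData n z p c A) :
    p - 1 ≤ ((nonSet n (fun a => (a : ℕ)) z).filter (fun q => q.1 ∈ A ∧ q.2 ∈ A)).card := by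
  have hp := H.p_pos
  have key : ∀ d, ∃ i, d + 1 < p →
      i < p ∧ (c i, c (i + (d + 1))) ∈ nonSet n (fun a => (a : ℕ)) z := by
    intro d
    by_cases hd : d + 1 < p
    · have hne : c 0 ≠ c (d + 1) := fun h => by
        have := H.hinj 0 (d + 1) hp hd h; omega
      obtain ⟨i, hi, h⟩ := window n z (c 0) (c (d + 1)) hne p H.hodd (by
        rw [H.c_iter, H.c_iter, Nat.add_comm p, H.c_add_p, Nat.add_comm p, H.c_add_p])
      rw [H.c_iter, H.c_iter] at h
      exact ⟨i, fun _ => ⟨hi, h⟩⟩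
    · exact ⟨0, fun h => absurd h hd⟩
  choose f hf using key
  rw [← Finset.card_range (p - 1)]
  apply Finset.card_le_card_of_injOn (fun d => (c (f d), c (f d + (d + 1))))
  · intro d hd
    have hd' : d < p - 1 := by simpa using hd
    simp only [Finset.mem_coe, Finset.mem_filter]
    exact ⟨(hf d (by omega)).2, H.c_mem _, H.c_mem _⟩
  · intro d hd e he h
    have hd' : d < p - 1 := by simpa using hd
    have he' : e < p - 1 := by simpa using he
    simp only [Prod.mk.injEq] at h
    have h1 := H.hinj _ _ (hf d (by omega)).1 (hf e (by omega)).1 h.1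
    have h2 := h.2
    rw [← h1, ← H.c_mod, ← H.c_mod (f d + (e + 1))] at h2
    have h3 := H.hinj _ _ (Nat.mod_lt _ hp) (Nat.mod_lt _ hp) h2
    have h4 : d + 1 ≡ e + 1 [MOD p] := Nat.ModEq.add_left_cancel' (f d) h3
    have h5 := Nat.ModEq.eq_of_lt_of_lt h4 (by omega) (by omega)
    omega

lemma sameCycle_iter (z : Equiv.Perm (Fin n)) (x : Fin n) (i : ℕ) : z.SameCycle x (z^[i] x) :=
  ⟨i, by rw [zpow_natCast, Equiv.Perm.coe_pow]⟩

lemma lower_AC (H : OrbitData n z p c A) :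
    Aᶜ.card ≤ ((nonSet n (fun a => (a : ℕ)) z).filter (fun q => q.1 ∈ A ∧ q.2 ∉ A)).card := by
  classical
  have hp := H.p_pos
  let κ : Fin n → Quotient (Equiv.Perm.SameCycle.setoid z) := fun b => Quotient.mk _ b
  have hκ : ∀ a b, κ a = κ b ↔ z.SameCycle a b := fun a b => Quotient.eq
  have hκi : ∀ x i, κ (z^[i] x) = κ x := fun x i => ((hκ _ _).mpr (sameCycle_iter z x i)).symm
  rw [Finset.card_eq_sum_card_fiberwise (f := κ) (t := Finset.univ) (by simp),
    Finset.card_eq_sum_card_fiberwise (s := (nonSet n (fun a => (a : ℕ)) z).filter _)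
      (f := fun q => κ q.2) (t := Finset.univ) (by simp)]
  apply Finset.sum_le_sum
  intro k _
  by_cases hcase : ∃ b, b ∉ A ∧ κ b = k ∧ b < c 0
  · obtain ⟨b, hb, hbk, hlt⟩ := hcase
    obtain ⟨q, hq0, hqp, hqo, hq, hqi⟩ := H.hper' b
    have h1 : (Aᶜ.filter (fun x => κ x = k)).card ≤ q := by
      rw [← Finset.card_range q]
      refine le_trans (Finset.card_le_card (t := (Finset.range q).image (fun i => z^[i] b)) ?_)
        Finset.card_image_le
      intro x hx
      have hx' := (Finset.mem_filter.mp hx).2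
      rw [← hbk, eq_comm, hκ] at hx'
      obtain ⟨i, hi⟩ := hx'.exists_nat_pow_eq
      rw [Finset.mem_image]
      refine ⟨i % q, by simpa using Nat.mod_lt _ hq0, ?_⟩
      rw [Equiv.Perm.coe_pow] at hi
      rw [← hi]
      exact Function.IsPeriodicPt.iterate_mod_apply hq i
    refine h1.trans ?_
    have key : ∀ i, ∃ j, j < q ∧ (c (j + i), z^[j] b) ∈ nonSet n (fun a => (a : ℕ)) z := by
      intro i
      obtain ⟨j, hj, h⟩ := window n z (c i) b (fun h => hb (h ▸ H.c_mem i)) q hqo (by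
        rw [hq, H.c_iter]
        exact iff_of_false (not_lt.mpr (hlt.le.trans (H.hmin _ (H.c_mem _))))
          (not_lt.mpr (hlt.le.trans (H.hmin _ (H.c_mem _)))))
      rw [H.c_iter] at h
      exact ⟨j, hj, h⟩
    choose f hf hf' using key
    have hbi : ∀ i, z^[i] b ∉ A := fun i => by rw [H.iter_mem_iff]; exact hb
    rw [← Finset.card_range q]
    apply Finset.card_le_card_of_injOn (fun i => (c (f i + i), z^[f i] b))
    · intro i _
      simp only [Finset.mem_coe, Finset.mem_filter]
      exact ⟨⟨hf' i, H.c_mem _, hbi _⟩, by rw [hκi]; exact hbk⟩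
    · intro i hi i' hi' h
      have hi : i < q := by simpa using hi
      have hi' : i' < q := by simpa using hi'
      simp only [Prod.mk.injEq] at h
      have h1 := hqi _ _ (hf i) (hf i') h.2
      have h2 := h.1
      rw [← h1, ← H.c_mod, ← H.c_mod (f i + i')] at h2
      have h3 := H.hinj _ _ (Nat.mod_lt _ hp) (Nat.mod_lt _ hp) h2
      have h4 : i ≡ i' [MOD p] := Nat.ModEq.add_left_cancel' (f i) h3
      exact Nat.ModEq.eq_of_lt_of_lt h4 (by omega) (by omega)
  · push Not at hcase
    have key : ∀ b, ∃ i, b ∉ A → κ b = k →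
        i < p ∧ (c i, z^[i] b) ∈ nonSet n (fun a => (a : ℕ)) z := by
      intro b
      by_cases hb : b ∉ A ∧ κ b = k
      · have hle := hcase b hb.1 hb.2
        have hne : c 0 ≠ b := fun h => hb.1 (h ▸ H.c_mem 0)
        have hle2 := hcase (z^[p] b) (by rw [H.iter_mem_iff]; exact hb.1) (by rw [hκi]; exact hb.2)
        have hne2 : c 0 ≠ z^[p] b := fun h => by
          have := (H.iter_mem_iff p b).mp (h ▸ H.c_mem 0)
          exact hb.1 this
        obtain ⟨i, hi, h⟩ := window n z (c 0) b hne p H.hodd (by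
          rw [H.hper]
          exact iff_of_true (lt_of_le_of_ne hle hne) (lt_of_le_of_ne hle2 hne2))
        rw [← H.hc] at h
        exact ⟨i, fun _ _ => ⟨hi, h⟩⟩
      · exact ⟨0, fun h1 h2 => absurd ⟨h1, h2⟩ hb⟩
    choose f hf using key
    apply Finset.card_le_card_of_injOn (fun b => (c (f b), z^[f b] b))
    · intro b hb
      simp only [Finset.mem_coe, Finset.mem_filter, Finset.mem_compl] at hb ⊢
      refine ⟨⟨(hf b hb.1 hb.2).2, H.c_mem _, ?_⟩, ?_⟩
      · rw [H.iter_mem_iff]; exact hb.1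
      · rw [hκi]; exact hb.2
    · intro b hb b' hb' h
      simp only [Finset.mem_coe, Finset.mem_filter, Finset.mem_compl] at hb hb'
      simp only [Prod.mk.injEq] at h
      have h1 := H.hinj _ _ (hf b hb.1 hb.2).1 (hf b' hb'.1 hb'.2).1 h.1
      rw [← h1] at h
      exact z.injective.iterate _ h.2

lemma split_card (g : Fin n → ℕ) (hg : Function.Injective g) (A : Finset (Fin n)) :
    (nonSet n g z).card = ((nonSet n g z).filter (fun q => q.1 ∈ A ∧ q.2 ∈ A)).card +
      2 * ((nonSet n g z).filter (fun q => q.1 ∈ A ∧ q.2 ∉ A)).card +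
      ((nonSet n g z).filter (fun q => q.1 ∉ A ∧ q.2 ∉ A)).card := by
  have hsw : ((nonSet n g z).filter (fun q => q.1 ∉ A ∧ q.2 ∈ A)).card =
      ((nonSet n g z).filter (fun q => q.1 ∈ A ∧ q.2 ∉ A)).card := by
    apply Finset.card_nbij' Prod.swap Prod.swap
    all_goals try (intro q _; simp; done)
    all_goals
      rintro ⟨a, b⟩ hq
      simp only [Finset.mem_coe, Finset.mem_filter, mem_nonSet, Prod.swap_prod_mk] at hq ⊢
      obtain ⟨⟨h1, h2⟩, h3, h4⟩ := hq
      have k1 : g a ≠ g b := fun h => h1 (hg h)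
      have k2 : g (z a) ≠ g (z b) := fun h => h1 (z.injective (hg h))
      refine ⟨⟨Ne.symm h1, ?_⟩, h4, h3⟩
      omega
  have e1 := Finset.card_filter_add_card_filter_not (s := nonSet n g z) (fun q => q.1 ∈ A)
  have e2 := Finset.card_filter_add_card_filter_not
    (s := (nonSet n g z).filter (fun q => q.1 ∈ A)) (fun q => q.2 ∈ A)
  have e3 := Finset.card_filter_add_card_filter_not
    (s := (nonSet n g z).filter (fun q => ¬ q.1 ∈ A)) (fun q => q.2 ∈ A)
  simp only [Finset.filter_filter] at e2 e3
  omega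

/-- the new order -/
lemma exists_g (H : OrbitData n z p c A) : ∃ g : Fin n → ℕ, Function.Injective g ∧
    (∀ i < p, g (c i) = if Even i then i / 2 else 3 * n - i / 2) ∧
    (∀ x, x ∉ A → g x = n + x) := by
  classical
  have hpn : p ≤ n := by
    rw [← H.card_A]; simpa using Finset.card_le_univ A
  have : ∀ x, ∃ i, x ∈ A → i < p ∧ c i = x := by
    intro x
    by_cases h : x ∈ A
    · obtain ⟨i, hi⟩ := (H.hA x).mp h
      exact ⟨i, fun _ => hi⟩
    · exact ⟨0, fun h' => absurd h' h⟩
  choose f hf using this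
  refine ⟨fun x => if x ∈ A then (if Even (f x) then f x / 2 else 3 * n - f x / 2) else n + x,
    ?_, ?_, ?_⟩
  · intro x y h
    simp only at h
    have hx := x.2
    have hy := y.2
    by_cases h1 : x ∈ A <;> by_cases h2 : y ∈ A
    · rw [if_pos h1, if_pos h2] at h
      have q1 := hf x h1
      have q2 := hf y h2
      rw [← q1.2, ← q2.2]
      congr 1
      simp only [Nat.even_iff] at h
      split_ifs at h <;> omega
    · rw [if_pos h1, if_neg h2] at h
      have q1 := hf x h1
      split_ifs at h <;> omega
    · rw [if_neg h1, if_pos h2] at h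
      have q1 := hf y h2
      split_ifs at h <;> omega
    · rw [if_neg h1, if_neg h2] at h
      exact Fin.ext (by omega)
  · intro i hi
    have h1 := hf (c i) (H.c_mem i)
    have h2 := H.hinj _ _ h1.1 hi h1.2
    simp only [H.c_mem i, if_true, h2]
  · intro x hx
    simp only [hx, if_false]

lemma upper (H : OrbitData n z p c A) (g : Fin n → ℕ) (hg : Function.Injective g)
    (hgc : ∀ i < p, g (c i) = if Even i then i / 2 else 3 * n - i / 2)
    (hgx : ∀ x, x ∉ A → g x = n + x) : (nonSet n g z).card ≤ cnt n z := by
  have hpn : p ≤ n := by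
    rw [← H.card_A]; simpa using Finset.card_le_univ A
  have hp := H.p_pos
  obtain ⟨h, hh⟩ := H.hodd
  have eqn := Fin.val_injective (n := n)
  unfold cnt
  rw [split_card g hg A, split_card (fun a => (a : ℕ)) eqn A]
  have l1 := H.lower_AA
  have l2 := H.lower_AC
  have gn : ∀ i < p, g (z (c i)) = if i + 1 = p then 0 else
      (if Even (i + 1) then (i + 1) / 2 else 3 * n - (i + 1) / 2) := by
    intro i hi
    rw [H.c_succ]
    split_ifs with h1 h2
    · rw [h1, H.c_p, hgc 0 hp]; simp
    · rw [hgc _ (by omega), if_pos h2]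
    · rw [hgc _ (by omega), if_neg h2]
  have u1 : ((nonSet n g z).filter (fun q => q.1 ∈ A ∧ q.2 ∈ A)).card ≤ p - 1 := by
    have hsub : (nonSet n g z).filter (fun q => q.1 ∈ A ∧ q.2 ∈ A) ⊆
        (Finset.range h).image (fun t => (c (p - 1), c (2 * t + 1))) ∪
        (Finset.range h).image (fun t => (c (2 * t + 1), c (p - 1))) := by
      rintro ⟨a, b⟩ hq
      simp only [Finset.mem_filter, mem_nonSet] at hq
      obtain ⟨⟨hab, hq⟩, ha, hb⟩ := hq
      obtain ⟨i, hi, rfl⟩ := (H.hA a).mp ha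
      obtain ⟨j, hj, rfl⟩ := (H.hA b).mp hb
      have hij : i ≠ j := fun e => hab (by rw [e])
      rw [gn i hi, gn j hj, hgc i hi, hgc j hj] at hq
      simp only [Nat.even_iff] at hq
      have key : (i = p - 1 ∧ j % 2 = 1) ∨ (j = p - 1 ∧ i % 2 = 1) := by
        by_contra hk
        rcases Nat.mod_two_eq_zero_or_one i with hi2 | hi2 <;>
        rcases Nat.mod_two_eq_zero_or_one j with hj2 | hj2 <;>
        split_ifs at hq <;> omega
      simp only [Finset.mem_union, Finset.mem_image, Finset.mem_range, Prod.mk.injEq]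
      rcases key with ⟨k1, k2⟩ | ⟨k1, k2⟩
      · left
        refine ⟨j / 2, by omega, by rw [k1], by congr 1; omega⟩
      · right
        refine ⟨i / 2, by omega, by congr 1; omega, by rw [k1]⟩
    refine (Finset.card_le_card hsub).trans ((Finset.card_union_le _ _).trans ?_)
    have e1 := Finset.card_image_le (s := Finset.range h)
      (f := fun t => (c (p - 1), c (2 * t + 1)))
    have e2 := Finset.card_image_le (s := Finset.range h)
      (f := fun t => (c (2 * t + 1), c (p - 1)))
    rw [Finset.card_range] at e1 e2
    omega
  have u2 : ((nonSet n g z).filter (fun q => q.1 ∈ A ∧ q.2 ∉ A)).card ≤ Aᶜ.card := by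
    have key : ∀ q ∈ (nonSet n g z).filter (fun q => q.1 ∈ A ∧ q.2 ∉ A), q.1 = c (p - 1) := by
      rintro ⟨a, b⟩ hq
      simp only [Finset.mem_filter, mem_nonSet] at hq
      obtain ⟨⟨hab, hq⟩, ha, hb⟩ := hq
      obtain ⟨i, hi, rfl⟩ := (H.hA a).mp ha
      rw [gn i hi, hgc i hi, hgx b hb, hgx (z b) (by rwa [H.mem_iff])] at hq
      simp only [Nat.even_iff] at hq
      have hb1 := b.2
      have hb2 := (z b).2
      have : i = p - 1 := by
        by_contra hk
        rcases Nat.mod_two_eq_zero_or_one i with hi2 | hi2 <;>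
        split_ifs at hq <;> omega
      simp [this]
    apply Finset.card_le_card_of_injOn Prod.snd
    · intro q hq
      have := (Finset.mem_filter.mp hq).2.2
      simpa using this
    · intro q hq q' hq' e
      exact Prod.ext ((key q hq).trans (key q' hq').symm) e
  have u3 : (nonSet n g z).filter (fun q => q.1 ∉ A ∧ q.2 ∉ A) =
      (nonSet n (fun a => (a : ℕ)) z).filter (fun q => q.1 ∉ A ∧ q.2 ∉ A) := by
    ext ⟨a, b⟩
    simp only [Finset.mem_filter, mem_nonSet]
    constructor
    all_goals
      rintro ⟨⟨h1, h2⟩, h3, h4⟩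
      refine ⟨⟨h1, ?_⟩, h3, h4⟩
      have e1 := hgx a h3
      have e2 := hgx b h4
      have e3 := hgx (z a) (by rwa [H.mem_iff])
      have e4 := hgx (z b) (by rwa [H.mem_iff])
      omega
  rw [u3]
  omega

end OrbitData

lemma exists_sigma (n : ℕ) (g : Fin n → ℕ) (hg : Function.Injective g) :
    ∃ σ : Equiv.Perm (Fin n), ∀ a b, σ a < σ b ↔ g a < g b := by
  refine ⟨(Tuple.sort g)⁻¹, fun a b => ?_⟩
  have hm : StrictMono (g ∘ Tuple.sort g) :=
    (Tuple.monotone_sort g).strictMono_of_injective (hg.comp (Tuple.sort g).injective)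
  rw [← hm.lt_iff_lt]
  simp

lemma cnt_conj (n : ℕ) (g : Fin n → ℕ) (z σ : Equiv.Perm (Fin n))
    (hs : ∀ a b, σ a < σ b ↔ g a < g b) : cnt n (σ * z * σ⁻¹) = (nonSet n g z).card := by
  symm
  unfold cnt
  apply Finset.card_bij (fun q _ => (σ q.1, σ q.2))
  · rintro ⟨a, b⟩ hq
    rw [mem_nonSet] at hq ⊢
    refine ⟨by simpa using hq.1, ?_⟩
    have := hq.2
    rw [← hs, ← hs] at this
    simpa using this
  · rintro ⟨a, b⟩ _ ⟨a', b'⟩ _ h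
    simpa using h
  · rintro ⟨a, b⟩ hq
    refine ⟨(σ⁻¹ a, σ⁻¹ b), ?_, by simp⟩
    rw [mem_nonSet] at hq ⊢
    refine ⟨by simpa using hq.1, ?_⟩
    have := hq.2
    simp only
    rw [← hs, ← hs]
    simpa using this

lemma big (n : ℕ) (z : Equiv.Perm (Fin n)) (p : ℕ) (c : ℕ → Fin n)
    (A : Finset (Fin n)) (H : OrbitData n z p c A) (hp5 : 5 ≤ p) :
    ∃ σ : Equiv.Perm (Fin n), cnt n (σ * z * σ⁻¹) ≤ cnt n z ∧
      (∀ a : Fin n, (a : ℕ) = 0 → (((σ * z * σ⁻¹) a : Fin n) : ℕ) = n - 1) ∧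
      (∀ a : Fin n, (a : ℕ) = n - 1 → (((σ * z * σ⁻¹) a : Fin n) : ℕ) = 1) ∧
      (∀ a : Fin n, (a : ℕ) = 1 → (((σ * z * σ⁻¹) a : Fin n) : ℕ) = n - 2) := by
  have hpn : p ≤ n := by
    rw [← H.card_A]; simpa using Finset.card_le_univ A
  obtain ⟨g, hg, hgc, hgx⟩ := H.exists_g
  obtain ⟨σ, hs⟩ := exists_sigma n g hg
  refine ⟨σ, ?_, ?_⟩
  · rw [cnt_conj n g z σ hs]; exact H.upper g hg hgc hgx
  have g0 : g (c 0) = 0 := by rw [hgc 0 (by omega)]; simp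
  have g1 : g (c 1) = 3 * n := by rw [hgc 1 (by omega)]; simp
  have g2 : g (c 2) = 1 := by rw [hgc 2 (by omega)]; simp
  have g3 : g (c 3) = 3 * n - 1 := by
    rw [hgc 3 (by omega)]; simp [Nat.even_iff]
  have gle : ∀ x, g x ≤ 3 * n := by
    intro x
    by_cases hx : x ∈ A
    · obtain ⟨i, hi, rfl⟩ := (H.hA x).mp hx
      rw [hgc i hi]; split_ifs <;> omega
    · rw [hgx x hx]; omega
  have hs' : ∀ a b, ((σ a : Fin n) : ℕ) < σ b ↔ g a < g b := hs
  have inv : ∀ m (hm : m < n), ∃ x, ((σ x : Fin n) : ℕ) = m := fun m hm =>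
    ⟨σ⁻¹ ⟨m, hm⟩, by simp⟩
  have s0 : ((σ (c 0) : Fin n) : ℕ) = 0 := by
    obtain ⟨x, hx⟩ := inv 0 (by omega)
    have := hs' x (c 0)
    omega
  have s1 : ((σ (c 1) : Fin n) : ℕ) = n - 1 := by
    obtain ⟨x, hx⟩ := inv (n - 1) (by omega)
    have := hs' (c 1) x
    have := gle x
    have := (σ (c 1)).2
    omega
  have s2 : ((σ (c 2) : Fin n) : ℕ) = 1 := by
    obtain ⟨x, hx⟩ := inv 1 (by omega)
    have := hs' (c 0) x
    have := hs' x (c 2)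
    have := hs' (c 0) (c 2)
    omega
  have s3 : ((σ (c 3) : Fin n) : ℕ) = n - 2 := by
    obtain ⟨x, hx⟩ := inv (n - 2) (by omega)
    have := hs' x (c 1)
    have := hs' (c 3) x
    have := hs' (c 3) (c 1)
    have := gle x
    omega
  have fin : ∀ (a x y : Fin n), (a : ℕ) = σ x → z x = y → (σ * z * σ⁻¹) a = σ y := by
    intro a x y h1 h2
    have : a = σ x := Fin.ext h1
    rw [this]
    simp [h2]
  refine ⟨fun a ha => ?_, fun a ha => ?_, fun a ha => ?_⟩
  · rw [fin a (c 0) (c 1) (by omega) (H.c_succ 0), s1]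
  · rw [fin a (c 1) (c 2) (by omega) (H.c_succ 1), s2]
  · rw [fin a (c 2) (c 3) (by omega) (H.c_succ 2), s3]

lemma minPer (n : ℕ) (z : Equiv.Perm (Fin n)) (x : Fin n) (hx : z x ≠ x) :
    Function.minimalPeriod z x = (z.cycleOf x).support.card := by
  have hcyc := Equiv.Perm.isCycle_cycleOf z hx
  rw [← hcyc.orderOf]
  apply Nat.dvd_right_iff_eq.mp
  intro m
  rw [← Function.isPeriodicPt_iff_minimalPeriod_dvd, orderOf_dvd_iff_pow_eq_one,
    hcyc.pow_eq_one_iff' (x := x) (by simpa using hx), Equiv.Perm.cycleOf_pow_apply_self,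
    Equiv.Perm.coe_pow]
  rfl

lemma exists_orbit (n : ℕ) (z : Equiv.Perm (Fin n)) (p : ℕ) (hp : p ∈ z.cycleType)
    (hpo : Odd p) (hall : ∀ q ∈ z.cycleType, Odd q ∧ q ≤ p) :
    ∃ c A, OrbitData n z p c A := by
  have hmem : ∀ x, z x ≠ x → Function.minimalPeriod z x ∈ z.cycleType := by
    intro x hx
    rw [minPer n z x hx, Equiv.Perm.cycleType_def, Multiset.mem_map]
    exact ⟨z.cycleOf x, by
      simpa [Equiv.Perm.cycleOf_mem_cycleFactorsFinset_iff] using hx, rfl⟩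
  obtain ⟨x, hx, hxp⟩ : ∃ x, z x ≠ x ∧ Function.minimalPeriod z x = p := by
    rw [Equiv.Perm.cycleType_def, Multiset.mem_map] at hp
    obtain ⟨f, hf, hfp⟩ := hp
    have hf : f ∈ z.cycleFactorsFinset := hf
    obtain ⟨x, hx⟩ := (Equiv.Perm.mem_cycleFactorsFinset_iff.mp hf).1.nonempty_support
    have he := Equiv.Perm.cycle_is_cycleOf hx hf
    have hx' : z x ≠ x := by
      have := Equiv.Perm.mem_cycleFactorsFinset_support_le hf hx
      simpa using this
    exact ⟨x, hx', by rw [minPer n z x hx', ← he]; exact hfp⟩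
  have hpp := hpo.pos
  let A : Finset (Fin n) := (Finset.range p).image (fun i => z^[i] x)
  have hne : A.Nonempty := ⟨x, by
    simp only [A, Finset.mem_image, Finset.mem_range]; exact ⟨0, hpp, rfl⟩⟩
  obtain ⟨k, hk, hkx⟩ : ∃ k < p, z^[k] x = A.min' hne := by
    have := A.min'_mem hne
    simpa only [A, Finset.mem_image, Finset.mem_range] using this
  have hper : Function.minimalPeriod z (z^[k] x) = p := by
    rw [Function.minimalPeriod_apply_iterate, hxp]
    rw [Function.mem_periodicPts]
    exact ⟨p, hpp, hxp ▸ Function.isPeriodicPt_minimalPeriod z x⟩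
  have hiter : ∀ (y : Fin n) i j, i < Function.minimalPeriod z y → j < Function.minimalPeriod z y →
      z^[i] y = z^[j] y → i = j := fun y i j hi hj h =>
    (Function.iterate_eq_iterate_iff_of_lt_minimalPeriod hi hj).mp h
  refine ⟨fun i => z^[i] (z^[k] x), A, ⟨hpo, fun i => rfl, ?_, ?_, ?_, ?_, ?_⟩⟩
  · simp only [Function.iterate_zero, id_eq]
    conv_lhs => rw [← hper]
    exact Function.isPeriodicPt_minimalPeriod z _
  · intro i j hi hj h
    exact hiter _ i j (by omega) (by omega) h
  · intro y
    have hP : Function.IsPeriodicPt z p x := hxp ▸ Function.isPeriodicPt_minimalPeriod z x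
    simp only [A, Finset.mem_image, Finset.mem_range, ← Function.iterate_add_apply]
    constructor
    · rintro ⟨i, hi, rfl⟩
      refine ⟨(i + (p - k)) % p, Nat.mod_lt _ hpp, ?_⟩
      rw [← hP.iterate_mod_apply, Nat.mod_add_mod]
      have : i + (p - k) + k = i + p := by omega
      rw [this, hP.iterate_mod_apply, Function.iterate_add_apply, hP.eq]
    · rintro ⟨i, hi, rfl⟩
      exact ⟨(i + k) % p, Nat.mod_lt _ hpp, hP.iterate_mod_apply _⟩
  · intro y hy
    simp only [Function.iterate_zero, id_eq]
    rw [hkx]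
    exact Finset.min'_le _ _ hy
  · intro y
    by_cases hy : z y = y
    · refine ⟨1, by omega, by omega, by decide, hy, ?_⟩
      intro i j hi hj _
      omega
    · have h1 := hall _ (hmem y hy)
      exact ⟨_, h1.1.pos, h1.2, h1.1, Function.isPeriodicPt_minimalPeriod z y, hiter y⟩

lemma exists_perm_type (n : ℕ) (mu : Multiset ℕ) (hsum : mu.sum = n) (hodd : ∀ p ∈ mu, Odd p) :
    ∃ w : Equiv.Perm (Fin n), fullCycleType n w = mu := by
  have hsplit := Multiset.filter_add_not (fun q => 2 ≤ q) mu
  have hrep : Multiset.filter (fun q => ¬ 2 ≤ q) mu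
      = Multiset.replicate (Multiset.card (Multiset.filter (fun q => ¬ 2 ≤ q) mu)) 1 := by
    rw [Multiset.eq_replicate]
    refine ⟨rfl, ?_⟩
    intro b hb
    rw [Multiset.mem_filter] at hb
    have := (hodd b hb.1).pos
    omega
  set c := Multiset.card (Multiset.filter (fun q => ¬ 2 ≤ q) mu) with hc
  have hs : (Multiset.filter (fun q => 2 ≤ q) mu).sum + c = n := by
    rw [← hsum]
    conv_rhs => rw [← hsplit, hrep]
    simp
  obtain ⟨g, hg⟩ := (Equiv.Perm.exists_with_cycleType_iff (Fin n)
    (m := Multiset.filter (fun q => 2 ≤ q) mu)).2 ⟨by simp; omega, by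
      intro a ha; exact (Multiset.mem_filter.1 ha).2⟩
  refine ⟨g, ?_⟩
  unfold fullCycleType
  rw [hg]
  conv_rhs => rw [← hsplit, hrep]
  congr 2
  omega

lemma exists_minimal_in (n : ℕ) (mu : Multiset ℕ) (hsum : mu.sum = n)
    (hodd : ∀ p ∈ mu, Odd p) : ∃ x : Equiv.Perm (Fin n), isMinimalIn n mu x := by
  obtain ⟨w, hw⟩ := exists_perm_type n mu hsum hodd
  have hne : (Finset.univ.filter (fun x : Equiv.Perm (Fin n) =>
      fullCycleType n (x * Fin.revPerm) = mu)).Nonempty :=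
    ⟨w * Fin.revPerm, by simp only [Finset.mem_filter, Finset.mem_univ, true_and, rev_mul, hw]⟩
  obtain ⟨x, hx, hmin⟩ := Finset.exists_min_image _ (permLength n) hne
  refine ⟨x, (Finset.mem_filter.1 hx).2, fun z hz => hmin z ?_⟩
  exact Finset.mem_filter.2 ⟨Finset.mem_univ _, hz⟩

lemma fix_top (n i : ℕ) (x : Equiv.Perm (Fin n))
    (h : ∀ a : Fin n, (a : ℕ) < i → ((x a : Fin n) : ℕ) < i) (a : Fin n) (ha : i ≤ (a : ℕ)) :
    i ≤ ((x a : Fin n) : ℕ) := by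
  by_contra hlt
  push Not at hlt
  set S : Finset (Fin n) := Finset.univ.filter (fun a => (a : ℕ) < i)
  have hsub : S.image x ⊆ S := by
    intro b hb
    obtain ⟨c, hc, rfl⟩ := Finset.mem_image.1 hb
    simp only [S, Finset.mem_filter, Finset.mem_univ, true_and] at hc ⊢
    exact h c hc
  have heq : S.image x = S :=
    Finset.eq_of_subset_of_card_le hsub (by rw [Finset.card_image_of_injective _ x.injective])
  have : x a ∈ S.image x := by rw [heq]; simpa [S] using hlt
  obtain ⟨c, hc, hca⟩ := Finset.mem_image.1 this
  have := x.injective hca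
  subst this
  simp only [S, Finset.mem_filter, Finset.mem_univ, true_and] at hc
  omega

lemma not_classLE_big (n k : ℕ) (hk : 3 * k ≤ n) (mu : Multiset ℕ) (hsum : mu.sum = n)
    (hodd : ∀ p ∈ mu, Odd p) (p : ℕ) (hp : p ∈ mu) (hp5 : 5 ≤ p) :
    ¬ classLE n (Multiset.replicate k 3 + Multiset.replicate (n - 3 * k) 1) mu := by
  intro hle
  have hmax : ∃ p ∈ mu, 5 ≤ p ∧ ∀ q ∈ mu, q ≤ p := by
    obtain ⟨m, hm, hmm⟩ := Finset.exists_max_image mu.toFinset id ⟨p, by simpa using hp⟩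
    refine ⟨m, by simpa using hm, ?_, fun q hq => hmm q (by simpa using hq)⟩
    exact hp5.trans (hmm p (by simpa using hp))
  obtain ⟨p, hp, hp5, hpm⟩ := hmax
  have hpn : p ≤ n := hsum ▸ Multiset.single_le_sum (fun _ _ => Nat.zero_le _) p hp
  obtain ⟨x0, hx0, hx0min⟩ := exists_minimal_in n mu hsum hodd
  unfold inClass at hx0
  set z := x0 * Fin.revPerm with hz
  have hzc : ∀ q ∈ z.cycleType, q ∈ mu := fun q hq => by
    rw [← hx0]; exact Multiset.mem_add.2 (Or.inl hq)
  have hpz : p ∈ z.cycleType := by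
    have : p ∈ fullCycleType n z := by rw [hx0]; exact hp
    rcases Multiset.mem_add.1 this with h | h
    · exact h
    · have := Multiset.eq_of_mem_replicate h
      omega
  obtain ⟨c, A, H⟩ := exists_orbit n z p hpz (hodd p hp)
    (fun q hq => ⟨hodd q (hzc q hq), hpm q (hzc q hq)⟩)
  obtain ⟨σ, hcnt, h0, h1, h2⟩ := big n z p c A H hp5
  set y := σ * z * σ⁻¹ with hy
  have hyc : fullCycleType n y = mu := by
    rw [← hx0]; unfold fullCycleType; rw [hy, Equiv.Perm.cycleType_conj]
  have hmin : isMinimalIn n mu (y * Fin.revPerm) := by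
    refine ⟨by unfold inClass; rw [rev_mul]; exact hyc, fun w hw => ?_⟩
    refine le_trans ?_ (hx0min w hw)
    have e1 := cnt_eq n (y * Fin.revPerm)
    have e2 := cnt_eq n x0
    rw [rev_mul] at e1
    rw [← hz] at e2
    omega
  obtain ⟨x', hx', hb⟩ := hle _ hmin
  have ht := (typ_iff n k hk _).1 hx'.1
  have hcube := ht.1
  have hxv : ∀ a b : Fin n, (a : ℕ) + b + 1 = n → (y * Fin.revPerm : Equiv.Perm (Fin n)) a = y b := by
    intro a b hab
    have : Fin.rev a = b := by ext; simp [Fin.val_rev]; omega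
    simp [this]
  have hxv' : ∀ a b : Fin n, (a : ℕ) + b + 1 = n → (x' * Fin.revPerm : Equiv.Perm (Fin n)) a = x' b := by
    intro a b hab
    have : Fin.rev a = b := by ext; simp [Fin.val_rev]; omega
    simp [this]
  have X1 : (y * Fin.revPerm : Equiv.Perm (Fin n)) ⟨n - 1, by omega⟩ = ⟨n - 1, by omega⟩ := by
    rw [hxv _ ⟨0, by omega⟩ (by simp; omega)]
    exact Fin.ext (h0 _ rfl)
  have X2 : (y * Fin.revPerm : Equiv.Perm (Fin n)) ⟨n - 2, by omega⟩ = ⟨n - 2, by omega⟩ := by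
    rw [hxv _ ⟨1, by omega⟩ (by simp; omega)]
    exact Fin.ext (h2 _ rfl)
  have X0 : (y * Fin.revPerm : Equiv.Perm (Fin n)) ⟨0, by omega⟩ = ⟨1, by omega⟩ := by
    rw [hxv _ ⟨n - 1, by omega⟩ (by simp; omega)]
    exact Fin.ext (h1 _ rfl)
  have ne1 : ∀ a : Fin n, (a : ℕ) ≠ n - 1 → (((y * Fin.revPerm : Equiv.Perm (Fin n)) a : Fin n) : ℕ) ≠ n - 1 := by
    intro a ha he
    apply ha
    have : (y * Fin.revPerm : Equiv.Perm (Fin n)) a = (y * Fin.revPerm : Equiv.Perm (Fin n)) ⟨n - 1, by omega⟩ := by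
      rw [X1]; exact Fin.ext he
    exact congrArg Fin.val ((y * Fin.revPerm : Equiv.Perm (Fin n)).injective this)
  have ne2 : ∀ a : Fin n, (a : ℕ) ≠ n - 2 → (((y * Fin.revPerm : Equiv.Perm (Fin n)) a : Fin n) : ℕ) ≠ n - 2 := by
    intro a ha he
    apply ha
    have : (y * Fin.revPerm : Equiv.Perm (Fin n)) a = (y * Fin.revPerm : Equiv.Perm (Fin n)) ⟨n - 2, by omega⟩ := by
      rw [X2]; exact Fin.ext he
    exact congrArg Fin.val ((y * Fin.revPerm : Equiv.Perm (Fin n)).injective this)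
  have B1 := bruhat_bound hb (n - 1) (n - 1) (by
    intro a ha
    have := ne1 a (by omega)
    have := ((y * Fin.revPerm : Equiv.Perm (Fin n)) a).isLt
    omega)
  have B2 := bruhat_bound hb (n - 2) (n - 2) (by
    intro a ha
    have := ne1 a (by omega)
    have := ne2 a (by omega)
    have := ((y * Fin.revPerm : Equiv.Perm (Fin n)) a).isLt
    omega)
  have B0 := bruhat_bound hb 1 2 (by
    intro a ha
    have : a = ⟨0, by omega⟩ := Fin.ext (by simpa using ha)
    rw [this, X0]
    simp)
  have C1 : x' ⟨n - 1, by omega⟩ = ⟨n - 1, by omega⟩ := by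
    have := fix_top n (n - 1) x' B1 ⟨n - 1, by omega⟩ (le_refl _)
    have := (x' ⟨n - 1, by omega⟩).isLt
    ext; simp only; omega
  have C2 : x' ⟨n - 2, by omega⟩ = ⟨n - 2, by omega⟩ := by
    have h3 := fix_top n (n - 2) x' B2 ⟨n - 2, by omega⟩ (le_refl _)
    have h4 := (x' ⟨n - 2, by omega⟩).isLt
    have h5 := B1 ⟨n - 2, by omega⟩ (by simp only; omega)
    ext; simp only; omega
  have C0 := B0 ⟨0, by omega⟩ (by simp)
  have Y0 : (x' * Fin.revPerm : Equiv.Perm (Fin n)) ⟨0, by omega⟩ = ⟨n - 1, by omega⟩ := by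
    rw [hxv' _ ⟨n - 1, by omega⟩ (by simp; omega), C1]
  have Y1 : (x' * Fin.revPerm : Equiv.Perm (Fin n)) ⟨1, by omega⟩ = ⟨n - 2, by omega⟩ := by
    rw [hxv' _ ⟨n - 2, by omega⟩ (by simp; omega), C2]
  have Y2 : (x' * Fin.revPerm : Equiv.Perm (Fin n)) ⟨n - 1, by omega⟩ = x' ⟨0, by omega⟩ :=
    hxv' _ ⟨0, by omega⟩ (by simp; omega)
  have hc0 := hcube ⟨0, by omega⟩
  rw [Y0, Y2] at hc0
  rcases Nat.lt_or_ge (x' ⟨0, by omega⟩ : Fin n).val 1 with h | h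
  · have e : x' ⟨0, by omega⟩ = ⟨0, by omega⟩ := Fin.ext (by simpa using h)
    rw [e, Y0] at hc0
    have := congrArg Fin.val hc0
    simp at this
    omega
  · have e : x' ⟨0, by omega⟩ = ⟨1, by omega⟩ := Fin.ext (by simp only; omega)
    rw [e, Y1] at hc0
    have := congrArg Fin.val hc0
    simp at this
    omega

lemma sort_type (j m : ℕ) :
    (Multiset.replicate j 3 + Multiset.replicate m 1 : Multiset ℕ).sort (· ≥ ·)
      = List.replicate j 3 ++ List.replicate m 1 := by
  have hc : (Multiset.replicate j 3 + Multiset.replicate m 1 : Multiset ℕ)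
      = ((List.replicate j 3 ++ List.replicate m 1 : List ℕ) : Multiset ℕ) := by
    rw [← Multiset.coe_add, Multiset.coe_replicate, Multiset.coe_replicate]
  apply List.Perm.eq_of_pairwise' (r := (· ≥ ·))
  · exact Multiset.pairwise_sort _ _
  · rw [List.pairwise_append]
    refine ⟨by simp [List.pairwise_replicate], by simp [List.pairwise_replicate], ?_⟩
    intro a ha b hb
    rw [List.eq_of_mem_replicate ha, List.eq_of_mem_replicate hb]
    norm_num
  · rw [← Multiset.coe_eq_coe, Multiset.sort_eq, hc]

lemma take_sum (j m i : ℕ) :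
    (((Multiset.replicate j 3 + Multiset.replicate m 1 : Multiset ℕ).sort (· ≥ ·)).take i).sum
      = 3 * min i j + min (i - j) m := by
  rw [sort_type, List.take_append, List.take_replicate, List.take_replicate, List.sum_append,
    List.sum_replicate, List.sum_replicate]
  simp
  ring

lemma dom_iff (n j k : ℕ) (hj : 3 * j ≤ n) (hk : 3 * k ≤ n) :
    domLE (Multiset.replicate j 3 + Multiset.replicate (n - 3 * j) 1)
      (Multiset.replicate k 3 + Multiset.replicate (n - 3 * k) 1) ↔ j ≤ k := by
  unfold domLE
  simp only [take_sum]
  constructor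
  · intro h
    have := h j
    omega
  · intro h i
    omega

lemma dom_small (mu lam : Multiset ℕ) (h : domLE mu lam) (p : ℕ) (hp : p ∈ mu)
    (hl : ∀ q ∈ lam, q ≤ 3) : p ≤ 3 := by
  have h1 := h 1
  have hp' : p ∈ mu.sort (· ≥ ·) := (Multiset.mem_sort (· ≥ ·)).2 hp
  have hs := Multiset.pairwise_sort mu (· ≥ ·)
  have hb : ((lam.sort (· ≥ ·)).take 1).sum ≤ 3 := by
    have hm : ∀ q ∈ lam.sort (· ≥ ·), q ≤ 3 := fun q hq =>
      hl q ((Multiset.mem_sort (· ≥ ·)).1 hq)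
    cases hL : lam.sort (· ≥ ·) with
    | nil => simp
    | cons a t =>
      rw [hL] at hm
      simpa using hm a (by simp)
  have ha : p ≤ ((mu.sort (· ≥ ·)).take 1).sum := by
    cases hL : mu.sort (· ≥ ·) with
    | nil => rw [hL] at hp'; simp at hp'
    | cons a t =>
      rw [hL] at hp' hs
      rcases List.mem_cons.1 hp' with rfl | ht
      · simp
      · simpa using (List.pairwise_cons.1 hs).1 p ht
  omega

lemma small_form (n : ℕ) (mu : Multiset ℕ) (hsum : mu.sum = n)
    (h : ∀ p ∈ mu, p = 1 ∨ p = 3) :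
    ∃ j, 3 * j ≤ n ∧ mu = Multiset.replicate j 3 + Multiset.replicate (n - 3 * j) 1 := by
  have hsplit := Multiset.filter_add_not (fun q => q = 3) mu
  have hrep : Multiset.filter (fun q => ¬ q = 3) mu
      = Multiset.replicate (Multiset.card (Multiset.filter (fun q => ¬ q = 3) mu)) 1 := by
    rw [Multiset.eq_replicate]
    refine ⟨rfl, fun b hb => ?_⟩
    rw [Multiset.mem_filter] at hb
    have := h b hb.1
    tauto
  have hrep3 : Multiset.filter (fun q => q = 3) mu
      = Multiset.replicate (Multiset.card (Multiset.filter (fun q => q = 3) mu)) 3 := by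
    rw [Multiset.eq_replicate]
    exact ⟨rfl, fun b hb => (Multiset.mem_filter.1 hb).2⟩
  set c := Multiset.card (Multiset.filter (fun q => ¬ q = 3) mu)
  set j := Multiset.card (Multiset.filter (fun q => q = 3) mu)
  rw [hrep, hrep3] at hsplit
  have hs : j * 3 + c = n := by
    rw [← hsum, ← hsplit]; simp
  refine ⟨j, by omega, ?_⟩
  rw [← hsplit]
  congr 2
  omega

end S6

/-- For `λ = (3^k, 1^{n−3k})` and any partition `μ` of `n` with all parts odd,
`O_λ ≤ O_μ` iff `μ ⊴ λ` in the dominance order. -/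
theorem stmt6 (n k : ℕ) (hn : 1 ≤ n) (hk : 3 * k ≤ n)
    (mu : Multiset ℕ) (hsum : mu.sum = n) (hodd : ∀ p ∈ mu, Odd p) :
    classLE n (Multiset.replicate k 3 + Multiset.replicate (n - 3 * k) 1) mu ↔
      domLE mu (Multiset.replicate k 3 + Multiset.replicate (n - 3 * k) 1) := by
  by_cases hbig : ∃ p ∈ mu, 5 ≤ p
  · obtain ⟨p, hp, hp5⟩ := hbig
    constructor
    · intro h
      exact absurd h (S6.not_classLE_big n k hk mu hsum hodd p hp hp5)
    · intro h
      have := S6.dom_small mu _ h p hp (by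
        intro q hq
        rcases Multiset.mem_add.1 hq with hq | hq
        · exact (Multiset.eq_of_mem_replicate hq).le
        · have := Multiset.eq_of_mem_replicate hq
          omega)
      omega
  · push Not at hbig
    obtain ⟨j, hj, hmu⟩ := S6.small_form n mu hsum (by
      intro p hp
      have h1 := hbig p hp
      obtain ⟨m, hm⟩ := hodd p hp
      omega)
    rw [hmu, S6.dom_iff n j k hj hk]
    exact S6.classLE_iff n j k hj hk
end

section
/- Let λ = (λ₁ ≥ λ₂ ≥ ⋯) and μ = (μ₁ ≥ μ₂ ≥ ⋯) be two partitions of n all of whose parts are odd. If O_λ ≤ O_μ, then μ₁ ≤ λ₁. -/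
open Equiv Function

theorem period_of_moved {n : ℕ} (u : Perm (Fin n)) (a : Fin n) (h : u a ≠ a) :
    minimalPeriod u a = (u.cycleOf a).support.card := by
  have hc := Perm.isCycle_cycleOf u h
  have key : ∀ k, IsPeriodicPt u k a ↔ (u.cycleOf a).support.card ∣ k := by
    intro k
    rw [← hc.orderOf, orderOf_dvd_iff_pow_eq_one,
      hc.pow_eq_one_iff' (x := a) (by rwa [Perm.cycleOf_apply_self]),
      Perm.cycleOf_pow_apply_self, IsPeriodicPt, IsFixedPt, Perm.iterate_eq_pow]
  apply Nat.dvd_antisymm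
  · exact isPeriodicPt_iff_minimalPeriod_dvd.1 ((key _).2 dvd_rfl)
  · exact (key _).1 (isPeriodicPt_minimalPeriod _ _)

theorem mem_fullCycleType_iff {n : ℕ} (u : Perm (Fin n)) (p : ℕ) :
    p ∈ fullCycleType n u ↔ ∃ a, minimalPeriod u a = p := by
  have hcard : n - u.cycleType.sum = (u.supportᶜ).card := by
    rw [Perm.sum_cycleType, Finset.card_compl, Fintype.card_fin]
  unfold fullCycleType
  rw [Multiset.mem_add, hcard, Multiset.mem_replicate, Perm.cycleType_def, Multiset.mem_map]
  constructor
  · rintro (⟨c, hc, rfl⟩ | ⟨h0, rfl⟩)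
    · have hc' : c ∈ u.cycleFactorsFinset := hc
      have hcyc := (Perm.mem_cycleFactorsFinset_iff.1 hc').1
      obtain ⟨a, ha⟩ := hcyc.nonempty_support
      refine ⟨a, ?_⟩
      rw [period_of_moved u a, Perm.cycle_is_cycleOf ha hc']
      · rfl
      · exact Perm.mem_support.1 (Perm.mem_cycleFactorsFinset_support_le hc' ha)
    · obtain ⟨a, ha⟩ := Finset.card_ne_zero.1 h0
      refine ⟨a, minimalPeriod_eq_one_iff_isFixedPt.2 ?_⟩
      exact Perm.notMem_support.1 (Finset.mem_compl.1 ha)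
  · rintro ⟨a, rfl⟩
    by_cases h : u a = a
    · right
      refine ⟨Finset.card_ne_zero.2 ⟨a, by simpa using h⟩, minimalPeriod_eq_one_iff_isFixedPt.2 h⟩
    · left
      exact ⟨u.cycleOf a, by
          rw [Finset.mem_val]
          exact Perm.cycleOf_mem_cycleFactorsFinset_iff.2 (Perm.mem_support.2 h),
        (period_of_moved u a h).symm⟩

theorem fullCycleType_conj {n : ℕ} (u e : Perm (Fin n)) :
    fullCycleType n (e * u * e⁻¹) = fullCycleType n u := by
  simp [fullCycleType, Perm.cycleType_conj]

theorem exists_fullCycleType (n : ℕ) (mu : Multiset ℕ) (hs : mu.sum = n)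
    (hpos : ∀ p ∈ mu, 0 < p) : ∃ u : Perm (Fin n), fullCycleType n u = mu := by
  have hsplit : mu.filter (2 ≤ ·) + mu.filter (fun x => ¬ 2 ≤ x) = mu :=
    Multiset.filter_add_not _ _
  have hone : mu.filter (fun x => ¬ 2 ≤ x) =
      Multiset.replicate (Multiset.card (mu.filter (fun x => ¬ 2 ≤ x))) 1 := by
    refine Multiset.eq_replicate_card.2 ?_
    intro b hb
    rw [Multiset.mem_filter] at hb
    have := hpos b hb.1
    omega
  have hsum : (mu.filter (2 ≤ ·)).sum + Multiset.card (mu.filter (fun x => ¬ 2 ≤ x)) = n := by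
    rw [← hs]
    conv_rhs => rw [← hsplit, Multiset.sum_add]
    congr 1
    conv_rhs => rw [hone]
    simp
  obtain ⟨u, hu⟩ := (Perm.exists_with_cycleType_iff (Fin n) (m := mu.filter (2 ≤ ·))).2
    ⟨by rw [Fintype.card_fin]; omega, fun a ha => (Multiset.mem_filter.1 ha).2⟩
  refine ⟨u, ?_⟩
  unfold fullCycleType
  rw [hu]
  conv_rhs => rw [← hsplit, hone]
  congr 2
  omega

/-- the set of inversions -/
def invs {n : ℕ} (w : Perm (Fin n)) : Finset (Fin n × Fin n) :=
  Finset.univ.filter fun x => x.1 < x.2 ∧ w x.2 < w x.1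

theorem mem_invs {n : ℕ} (w : Perm (Fin n)) (x : Fin n × Fin n) :
    x ∈ invs w ↔ x.1 < x.2 ∧ w x.2 < w x.1 := by simp [invs]

theorem adj_lt {n : ℕ} (i j a b : Fin n) (hij : i.val + 1 = j.val) (hab : a < b)
    (hne : ¬ (a = i ∧ b = j)) : swap i j a < swap i j b := by
  simp only [swap_apply_def]
  rw [Fin.lt_def] at *
  simp only [Fin.ext_iff] at *
  split_ifs <;> omega

theorem inv_asc {n : ℕ} (w : Perm (Fin n)) (i j : Fin n) (hij : i.val + 1 = j.val)
    (h : w i < w j) : (invs (w * swap i j)).card = (invs w).card + 1 := by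
  have hlt : i < j := by rw [Fin.lt_def]; omega
  have h1 : (i, j) ∈ invs (w * swap i j) := by
    simp [mem_invs, h, hlt]
  have h2 : (i, j) ∉ invs w := by
    simp [mem_invs, h.le]
  rw [← Finset.card_erase_add_one h1]
  congr 1
  refine Finset.card_bij' (fun x _ => (swap i j x.1, swap i j x.2))
    (fun x _ => (swap i j x.1, swap i j x.2)) ?_ ?_ ?_ ?_
  · rintro ⟨a, b⟩ hab
    simp only [Finset.mem_erase, mem_invs, Perm.mul_apply, ne_eq, Prod.mk.injEq] at hab ⊢
    exact ⟨adj_lt i j a b hij hab.2.1 hab.1, hab.2.2⟩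
  · rintro ⟨a, b⟩ hab
    have hne : ¬ (a = i ∧ b = j) := by
      rintro ⟨rfl, rfl⟩; exact h2 hab
    simp only [Finset.mem_erase, mem_invs, Perm.mul_apply, ne_eq, Prod.mk.injEq,
      swap_apply_self] at hab ⊢
    refine ⟨?_, adj_lt i j a b hij hab.1 hne, hab.2⟩
    rintro ⟨h3, h4⟩
    have h5 : a = j := by rw [← swap_apply_self i j a, h3, swap_apply_left]
    have h6 : b = i := by rw [← swap_apply_self i j b, h4, swap_apply_right]
    have := hab.1
    rw [h5, h6] at this
    exact absurd this hlt.le.not_gt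
  · rintro ⟨a, b⟩ _; simp
  · rintro ⟨a, b⟩ _; simp

theorem inv_desc {n : ℕ} (w : Perm (Fin n)) (i j : Fin n) (hij : i.val + 1 = j.val)
    (h : w j < w i) : (invs (w * swap i j)).card + 1 = (invs w).card := by
  have := inv_asc (w * swap i j) i j hij (by simpa using h)
  rw [mul_assoc, swap_mul_self, mul_one] at this
  exact this.symm

theorem inv_le_length {n : ℕ} (l : List (Perm (Fin n))) (hl : IsAdjWord n l) :
    (invs l.prod).card ≤ l.length := by
  induction l using List.reverseRecOn with
  | nil =>
    simp only [List.prod_nil, List.length_nil, nonpos_iff_eq_zero, Finset.card_eq_zero]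
    ext ⟨a, b⟩
    simp only [mem_invs, Perm.one_apply, Finset.notMem_empty, iff_false, not_and, not_lt]
    exact fun h => h.le
  | append_singleton l s ih =>
    obtain ⟨i, h, hs⟩ := hl s (by simp)
    have ih' := ih (fun x hx => hl x (by simp [hx]))
    simp only [List.prod_append, List.prod_singleton, List.length_append, List.length_singleton]
    rw [hs]
    rcases lt_or_ge (l.prod ⟨i, Nat.lt_of_succ_lt h⟩) (l.prod ⟨i + 1, h⟩) with h1 | h1
    · rw [inv_asc _ _ _ rfl h1]; omega
    · have h2 := inv_desc l.prod ⟨i, Nat.lt_of_succ_lt h⟩ ⟨i + 1, h⟩ rfl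
        (lt_of_le_of_ne h1 (fun hh => by simpa using l.prod.injective hh))
      omega

theorem exists_word {n : ℕ} (k : ℕ) : ∀ w : Perm (Fin n), (invs w).card = k →
    ∃ l : List (Perm (Fin n)), IsAdjWord n l ∧ l.length = k ∧ l.prod = w := by
  induction k with
  | zero =>
    intro w hw
    refine ⟨[], by simp [IsAdjWord], rfl, ?_⟩
    rw [Finset.card_eq_zero] at hw
    have hm : StrictMono w := by
      intro a b hab
      by_contra hcon
      have : (a, b) ∈ invs w := by
        rw [mem_invs]
        exact ⟨hab, lt_of_le_of_ne (not_lt.1 hcon) (fun hh => hab.ne' (w.injective hh))⟩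
      rw [hw] at this
      simp at this
    have h1 : w.toOrderIso hm.monotone (by
      intro a b hab
      by_contra hcon
      have := hm (not_le.1 hcon)
      simp only [apply_symm_apply] at this
      exact absurd this hab.not_gt) = OrderIso.refl _ := Subsingleton.elim _ _
    ext a
    have h2 := congrArg (fun f : Fin n ≃o Fin n => f a) h1
    simp only [OrderIso.refl_apply] at h2
    simp only [List.prod_nil, Perm.one_apply]
    exact congrArg Fin.val h2.symm
  | succ k ih =>
    intro w hw
    by_cases hd : ∃ i, ∃ h : i + 1 < n, w ⟨i + 1, h⟩ < w ⟨i, Nat.lt_of_succ_lt h⟩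
    · obtain ⟨i, h, hlt⟩ := hd
      have h1 := inv_desc w ⟨i, Nat.lt_of_succ_lt h⟩ ⟨i + 1, h⟩ rfl hlt
      obtain ⟨l, hl, hlen, hprod⟩ := ih _ (Nat.succ_injective (h1.trans hw))
      refine ⟨l ++ [swap ⟨i, Nat.lt_of_succ_lt h⟩ ⟨i + 1, h⟩], ?_, by simp [hlen], ?_⟩
      · intro x hx
        rcases List.mem_append.1 hx with hx | hx
        · exact hl x hx
        · exact ⟨i, h, by simpa using hx⟩
      · rw [List.prod_append, hprod, List.prod_singleton, mul_assoc, swap_mul_self, mul_one]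
    · exfalso
      push Not at hd
      have hmono : ∀ d i : ℕ, ∀ h : i + d < n, w ⟨i, by omega⟩ ≤ w ⟨i + d, h⟩ := by
        intro d
        induction d with
        | zero => intro i h; exact le_rfl
        | succ d ihd => intro i h; exact (ihd i (by omega)).trans (hd (i + d) h)
      have : invs w = ∅ := by
        ext ⟨a, b⟩
        simp only [mem_invs, Finset.notMem_empty, iff_false, not_and, not_lt]
        intro hab
        rw [Fin.lt_def] at hab
        have := hmono (b.val - a.val) a.val (by omega)
        have e : (⟨a.val + (b.val - a.val), by omega⟩ : Fin n) = b := by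
          apply Fin.ext
          simp only
          omega
        rw [e] at this
        exact this
      rw [this] at hw
      simp at hw

theorem permLength_eq {n : ℕ} (w : Perm (Fin n)) : permLength n w = (invs w).card := by
  unfold permLength
  apply le_antisymm
  · exact Nat.sInf_le (exists_word _ w rfl)
  · refine le_csInf ⟨_, exists_word _ w rfl⟩ ?_
    rintro k ⟨l, hl, rfl, rfl⟩
    exact inv_le_length l hl

/-- rank function -/
def rk {n : ℕ} (w : Perm (Fin n)) (a b : ℕ) : ℕ :=
  (Finset.univ.filter fun j : Fin n => j.val < a ∧ b ≤ (w j).val).card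

theorem rk_succ {n : ℕ} (w : Perm (Fin n)) (a b : ℕ) (h : a < n) :
    rk w (a + 1) b = rk w a b + if b ≤ (w ⟨a, h⟩).val then 1 else 0 := by
  unfold rk
  split_ifs with hb
  · have : (Finset.univ.filter fun j : Fin n => j.val < a + 1 ∧ b ≤ (w j).val) =
      insert ⟨a, h⟩ (Finset.univ.filter fun j : Fin n => j.val < a ∧ b ≤ (w j).val) := by
      ext j
      simp only [Finset.mem_filter, Finset.mem_univ, true_and, Finset.mem_insert]
      constructor
      · rintro ⟨h1, h2⟩
        rcases Nat.lt_succ_iff_lt_or_eq.1 h1 with h3 | h3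
        · exact Or.inr ⟨h3, h2⟩
        · exact Or.inl (Fin.ext h3)
      · rintro (rfl | ⟨h1, h2⟩)
        · exact ⟨Nat.lt_succ_self _, hb⟩
        · exact ⟨by omega, h2⟩
    rw [this, Finset.card_insert_of_notMem (by simp)]
  · rw [add_zero]
    congr 1
    ext j
    simp only [Finset.mem_filter, Finset.mem_univ, true_and]
    constructor
    · rintro ⟨h1, h2⟩
      rcases Nat.lt_succ_iff_lt_or_eq.1 h1 with h3 | h3
      · exact ⟨h3, h2⟩
      · have : j = ⟨a, h⟩ := Fin.ext h3
        rw [this] at h2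
        exact absurd h2 hb
    · rintro ⟨h1, h2⟩; exact ⟨by omega, h2⟩

theorem rk_swap_ne {n : ℕ} (w : Perm (Fin n)) (a b i : ℕ) (h : i + 1 < n) (ha : a ≠ i + 1) :
    rk (w * swap ⟨i, Nat.lt_of_succ_lt h⟩ ⟨i + 1, h⟩) a b = rk w a b := by
  unfold rk
  refine Finset.card_bij' (fun x _ => swap ⟨i, Nat.lt_of_succ_lt h⟩ ⟨i + 1, h⟩ x)
    (fun x _ => swap ⟨i, Nat.lt_of_succ_lt h⟩ ⟨i + 1, h⟩ x) ?_ ?_ ?_ ?_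
  · intro x hx
    rw [Finset.mem_filter] at hx ⊢
    simp only [Finset.mem_univ, true_and, Perm.mul_apply] at hx ⊢
    refine ⟨?_, hx.2⟩
    have := hx.1
    simp only [swap_apply_def]
    simp only [Fin.ext_iff] at *
    split_ifs <;> first | omega | (simp only; omega)
  · intro x hx
    rw [Finset.mem_filter] at hx ⊢
    simp only [Finset.mem_univ, true_and, Perm.mul_apply, swap_apply_self] at hx ⊢
    refine ⟨?_, hx.2⟩
    have := hx.1
    simp only [swap_apply_def]
    simp only [Fin.ext_iff] at *
    split_ifs <;> first | omega | (simp only; omega)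
  · intro x _; simp
  · intro x _; simp

theorem rk_le_of_sublist {n : ℕ} (l : List (Perm (Fin n))) : IsAdjWord n l →
    l.length = (invs l.prod).card → ∀ l' : List (Perm (Fin n)), l'.Sublist l →
    ∀ a b, rk l'.prod a b ≤ rk l.prod a b := by
  induction l using List.reverseRecOn with
  | nil =>
    intro _ _ l' hl' a b
    rw [List.sublist_nil.1 hl']
  | append_singleton l s ih =>
    intro hl hred l' hl' a b
    obtain ⟨i, h, hs⟩ := hl s (by simp)
    have hl1 : IsAdjWord n l := fun x hx => hl x (by simp [hx])
    have hle := inv_le_length l hl1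
    simp only [List.prod_append, List.prod_singleton, List.length_append,
      List.length_singleton] at hred ⊢
    rw [hs] at hred ⊢
    have hasc : l.prod ⟨i, Nat.lt_of_succ_lt h⟩ < l.prod ⟨i + 1, h⟩ := by
      by_contra hcon
      have h2 := inv_desc l.prod ⟨i, Nat.lt_of_succ_lt h⟩ ⟨i + 1, h⟩ rfl
        (lt_of_le_of_ne (not_lt.1 hcon) (fun hh => by simpa using l.prod.injective hh))
      omega
    have h1 := inv_asc l.prod ⟨i, Nat.lt_of_succ_lt h⟩ ⟨i + 1, h⟩ rfl hasc
    have ih' := ih hl1 (by omega)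
    rw [Fin.lt_def] at hasc
    have e1 : swap (⟨i, Nat.lt_of_succ_lt h⟩ : Fin n) ⟨i + 1, h⟩ ⟨i, Nat.lt_of_succ_lt h⟩
      = ⟨i + 1, h⟩ := swap_apply_left _ _
    obtain ⟨l1, l2, rfl, hs1, hs2⟩ := List.sublist_append_iff.1 hl'
    have hc : l2 = [] ∨ l2 = [s] := by
      cases hs2 with
      | cons _ h => left; exact List.sublist_nil.1 h
      | cons_cons _ h => right; rw [List.sublist_nil.1 h]
    have ihs := ih' l1 hs1
    by_cases ha : a = i + 1
    · subst ha
      have r1 := rk_succ (l.prod * swap ⟨i, Nat.lt_of_succ_lt h⟩ ⟨i + 1, h⟩) i b (by omega)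
      rw [rk_swap_ne l.prod i b i h (by omega), Perm.mul_apply, e1] at r1
      have r2 := rk_succ l.prod i b (by omega)
      have r3 := rk_succ l.prod (i + 1) b (by omega)
      have q2 := rk_succ l1.prod i b (by omega)
      have q3 := rk_succ l1.prod (i + 1) b (by omega)
      have i1 := ihs i b
      have i2 := ihs (i + 1) b
      have i3 := ihs (i + 1 + 1) b
      rcases hc with rfl | rfl
      · rw [List.append_nil]
        split_ifs at * <;> omega
      · rw [List.prod_append, List.prod_singleton, hs]
        have q1 := rk_succ (l1.prod * swap ⟨i, Nat.lt_of_succ_lt h⟩ ⟨i + 1, h⟩) i b (by omega)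
        rw [rk_swap_ne l1.prod i b i h (by omega), Perm.mul_apply, e1] at q1
        split_ifs at * <;> omega
    · rw [rk_swap_ne _ _ _ _ h ha]
      rcases hc with rfl | rfl
      · rw [List.append_nil]; exact ihs a b
      · rw [List.prod_append, List.prod_singleton, hs, rk_swap_ne _ _ _ _ h ha]; exact ihs a b

/-- If `x' ≤ x` and `x` maps `[0,a)` into `[0,b)` then so does `x'`. -/
theorem bruhat_maps {n : ℕ} (x' x : Perm (Fin n)) (h : permBruhatLE n x' x) (a b : ℕ)
    (hx : ∀ j : Fin n, j.val < a → (x j).val < b) :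
    ∀ j : Fin n, j.val < a → (x' j).val < b := by
  obtain ⟨l, hl, rfl, hlen, l', hsub, rfl, -⟩ := h
  rw [permLength_eq] at hlen
  have h1 := rk_le_of_sublist l hl hlen l' hsub a b
  have h2 : rk l.prod a b = 0 := by
    rw [rk, Finset.card_eq_zero, Finset.filter_eq_empty_iff]
    rintro j - ⟨h3, h4⟩
    have := hx j h3
    omega
  rw [h2, nonpos_iff_eq_zero, rk, Finset.card_eq_zero, Finset.filter_eq_empty_iff] at h1
  intro j hj
  by_contra hcon
  exact h1 (Finset.mem_univ j) ⟨hj, not_lt.1 hcon⟩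

/-- ordered pairs of distinct elements whose relative order is preserved by `u` -/
def NV {n : ℕ} (u : Perm (Fin n)) : Finset (Fin n × Fin n) :=
  Finset.univ.filter fun x => x.1 ≠ x.2 ∧ (x.1 < x.2 ↔ u x.1 < u x.2)

theorem mem_NV {n : ℕ} (u : Perm (Fin n)) (a b : Fin n) :
    (a, b) ∈ NV u ↔ a ≠ b ∧ (a < b ↔ u a < u b) := by simp [NV]

theorem mem_NV_swap {n : ℕ} (u : Perm (Fin n)) (a b : Fin n) (h : (a, b) ∈ NV u) :
    (b, a) ∈ NV u := by
  rw [mem_NV] at h ⊢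
  obtain ⟨h1, h2⟩ := h
  refine ⟨h1.symm, ?_⟩
  have h3 : u a ≠ u b := fun h => h1 (u.injective h)
  rcases lt_or_gt_of_ne h1 with h4 | h4 <;> rcases lt_or_gt_of_ne h3 with h5 | h5
  · simp [h4.not_gt, h5.not_gt]
  · exact absurd (h2.1 h4) h5.not_gt
  · exact absurd (h2.2 h5) h4.not_gt
  · simp [h4, h5]

theorem card_NV {n : ℕ} (w : Perm (Fin n)) :
    (NV (w * Fin.revPerm)).card = 2 * (invs w).card := by
  rw [← Finset.card_filter_add_card_filter_not (fun x : Fin n × Fin n => x.1 < x.2), two_mul]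
  congr 1
  · refine Finset.card_bij' (fun x _ => (Fin.rev x.2, Fin.rev x.1))
      (fun x _ => (Fin.rev x.2, Fin.rev x.1)) ?_ ?_ ?_ ?_
    · rintro ⟨a, b⟩ hx
      rw [Finset.mem_filter, mem_NV] at hx
      rw [mem_invs]
      simp only [Perm.mul_apply, Fin.revPerm_apply, Fin.rev_lt_rev] at hx ⊢
      exact ⟨hx.2, hx.1.2.1 hx.2⟩
    · rintro ⟨a, b⟩ hx
      rw [mem_invs] at hx
      rw [Finset.mem_filter, mem_NV]
      simp only [Perm.mul_apply, Fin.revPerm_apply, Fin.rev_lt_rev, Fin.rev_rev] at hx ⊢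
      exact ⟨⟨fun h => hx.1.ne' (Fin.rev_injective h), by simp [hx.1, hx.2]⟩, hx.1⟩
    · rintro ⟨a, b⟩ _; simp
    · rintro ⟨a, b⟩ _; simp
  · refine Finset.card_bij' (fun x _ => (Fin.rev x.1, Fin.rev x.2))
      (fun x _ => (Fin.rev x.1, Fin.rev x.2)) ?_ ?_ ?_ ?_
    · rintro ⟨a, b⟩ hx
      rw [Finset.mem_filter] at hx
      have h1 := hx.1
      have h1' := mem_NV_swap _ _ _ h1
      rw [mem_NV] at h1'
      rw [mem_invs]
      have h2 : b < a := lt_of_le_of_ne (not_lt.1 hx.2) h1'.1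
      simp only [Perm.mul_apply, Fin.revPerm_apply, Fin.rev_lt_rev] at h1' ⊢
      exact ⟨h2, h1'.2.1 h2⟩
    · rintro ⟨a, b⟩ hx
      rw [mem_invs] at hx
      rw [Finset.mem_filter, mem_NV]
      simp only [Perm.mul_apply, Fin.revPerm_apply, Fin.rev_lt_rev, Fin.rev_rev] at hx ⊢
      exact ⟨⟨fun h => hx.1.ne (Fin.rev_injective h), by simp [hx.1.not_gt, hx.2.not_gt]⟩,
        hx.1.not_gt⟩
    · rintro ⟨a, b⟩ _; simp
    · rintro ⟨a, b⟩ _; simp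

theorem alternating (f : ℕ → Prop) (i0 k : ℕ)
    (h : ∀ i, i0 ≤ i → i < i0 + k → (f i ↔ ¬ f (i + 1))) :
    f (i0 + k) ↔ (f i0 ↔ Even k) := by
  induction k with
  | zero => simp
  | succ k ih =>
    have h1 := ih (fun i h1 h2 => h i h1 (by omega))
    have h2 := h (i0 + k) (by omega) (by omega)
    rw [Nat.even_add_one]
    rw [← add_assoc]
    tauto

/-- Key dichotomy along an orbit of pairs. -/
theorem exists_nv {n : ℕ} (u : Perm (Fin n)) (a b : Fin n) (hne : a ≠ b) (i0 k : ℕ)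
    (h : ¬ (u^[i0 + k] a < u^[i0 + k] b ↔ (u^[i0] a < u^[i0] b ↔ Even k))) :
    ∃ i, i0 ≤ i ∧ i < i0 + k ∧ (u^[i] a, u^[i] b) ∈ NV u := by
  by_contra hcon
  push Not at hcon
  apply h
  apply alternating (fun i => u^[i] a < u^[i] b)
  intro i h1 h2
  have h3 := hcon i h1 h2
  rw [mem_NV] at h3
  have h4 : u^[i] a ≠ u^[i] b := fun h => hne (u.injective.iterate i h)
  simp only [iterate_succ_apply']
  tauto

/-- the cycle of `a` -/
noncomputable def cyc {n : ℕ} (u : Perm (Fin n)) (a : Fin n) : Finset (Fin n) :=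
  (Finset.range (minimalPeriod u a)).image fun i => u^[i] a

theorem period_pos {n : ℕ} (u : Perm (Fin n)) (a : Fin n) : 0 < minimalPeriod u a :=
  minimalPeriod_pos_of_mem_periodicPts (u.injective.mem_periodicPts a)

theorem iter_inj {n : ℕ} (u : Perm (Fin n)) (a : Fin n) {i j : ℕ} (hi : i < minimalPeriod u a)
    (hj : j < minimalPeriod u a) (h : u^[i] a = u^[j] a) : i = j :=
  (iterate_eq_iterate_iff_of_lt_minimalPeriod hi hj).1 h

theorem mem_cyc {n : ℕ} (u : Perm (Fin n)) (a b : Fin n) : b ∈ cyc u a ↔ ∃ i, u^[i] a = b := by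
  unfold cyc
  rw [Finset.mem_image]
  constructor
  · rintro ⟨i, -, h⟩; exact ⟨i, h⟩
  · rintro ⟨i, h⟩
    exact ⟨i % minimalPeriod u a, Finset.mem_range.2 (Nat.mod_lt _ (period_pos u a)),
      by rw [← h]; exact iterate_mod_minimalPeriod_eq⟩

theorem card_cyc {n : ℕ} (u : Perm (Fin n)) (a : Fin n) :
    (cyc u a).card = minimalPeriod u a := by
  unfold cyc
  rw [Finset.card_image_of_injOn, Finset.card_range]
  intro i hi j hj h
  exact iter_inj u a (by simpa using hi) (by simpa using hj) h

theorem apply_mem_cyc {n : ℕ} (u : Perm (Fin n)) (a b : Fin n) :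
    u b ∈ cyc u a ↔ b ∈ cyc u a := by
  rw [mem_cyc, mem_cyc]
  constructor
  · rintro ⟨i, h⟩
    have hp := period_pos u a
    refine ⟨i + minimalPeriod u a - 1, u.injective ?_⟩
    rw [← iterate_succ_apply' u, ← h]
    have : (i + minimalPeriod u a - 1).succ = i + minimalPeriod u a := by omega
    rw [this]
    exact iterate_add_minimalPeriod_eq
  · rintro ⟨i, h⟩
    exact ⟨i + 1, by rw [iterate_succ_apply', h]⟩

theorem within {n : ℕ} (u : Perm (Fin n)) (a : Fin n) (hodd : Odd (minimalPeriod u a)) :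
    minimalPeriod u a - 1 ≤
      ((NV u).filter fun x => x.1 ∈ cyc u a ∧ x.2 ∈ cyc u a).card := by
  have key : ∀ k ∈ Finset.Ico 1 (minimalPeriod u a), ∃ i, i < minimalPeriod u a ∧
      (u^[i] a, u^[i] (u^[k] a)) ∈ NV u := by
    intro k hk
    rw [Finset.mem_Ico] at hk
    have hne : a ≠ u^[k] a := by
      intro h
      have := iter_inj u a (i := 0) (j := k) (by omega) hk.2 h
      omega
    obtain ⟨i, -, h1, h2⟩ := exists_nv u a (u^[k] a) hne 0 (minimalPeriod u a) (by
      rw [zero_add, ← iterate_add_apply, add_comm, iterate_add_apply, iterate_minimalPeriod]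
      have := Nat.not_even_iff_odd.2 hodd
      simp only [iterate_zero, id]
      tauto)
    exact ⟨i, by omega, h2⟩
  choose! f hf1 hf2 using key
  rw [← Nat.card_Ico]
  apply Finset.card_le_card_of_injOn (fun k => (u^[f k] a, u^[f k] (u^[k] a)))
  · intro k hk
    have hk' : k ∈ Finset.Ico 1 (minimalPeriod u a) := hk
    show _ ∈ Finset.filter _ _
    rw [Finset.mem_filter]
    refine ⟨hf2 k hk', (mem_cyc _ _ _).2 ⟨_, rfl⟩, (mem_cyc _ _ _).2 ⟨f k + k, ?_⟩⟩
    rw [iterate_add_apply]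
  · intro k hk k' hk' h
    have hk1 : k ∈ Finset.Ico 1 (minimalPeriod u a) := hk
    have hk1' : k' ∈ Finset.Ico 1 (minimalPeriod u a) := hk'
    simp only [Prod.mk.injEq] at h
    have h1 := iter_inj u a (hf1 k hk1) (hf1 k' hk1') h.1
    have h2 := h.2
    rw [h1] at h2
    exact iter_inj u a (Finset.mem_Ico.1 hk1).2 (Finset.mem_Ico.1 hk1').2
      (u.injective.iterate _ h2)

theorem iter_mem {n : ℕ} (u : Perm (Fin n)) (D : Finset (Fin n)) (hD : ∀ b ∈ D, u b ∈ D)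
    (i : ℕ) : ∀ b ∈ D, u^[i] b ∈ D := by
  induction i with
  | zero => intro b hb; exact hb
  | succ i ih => intro b hb; rw [iterate_succ_apply']; exact hD _ (ih b hb)

theorem mixed {n : ℕ} (u : Perm (Fin n)) (a : Fin n) (hodd : Odd (minimalPeriod u a))
    (q : ℕ) (hq : Odd q) (hqp : q ≤ minimalPeriod u a) (D : Finset (Fin n))
    (hD : ∀ b ∈ D, u b ∈ D) (hDq : ∀ b ∈ D, u^[q] b = b) (hDC : ∀ b ∈ D, b ∉ cyc u a) :
    D.card ≤ ((NV u).filter fun x => x.1 ∈ cyc u a ∧ x.2 ∈ D).card := by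
  set p := minimalPeriod u a with hp
  have hne : ∀ b ∈ D, a ≠ b := fun b hb h => hDC b hb (h ▸ (mem_cyc u a a).2 ⟨0, rfl⟩)
  set S := (Finset.range p ×ˢ D).filter fun x => (u^[x.1] a, u^[x.1] x.2) ∈ NV u with hS
  have h1 : S.card ≤ ((NV u).filter fun x => x.1 ∈ cyc u a ∧ x.2 ∈ D).card := by
    apply Finset.card_le_card_of_injOn (fun x => (u^[x.1] a, u^[x.1] x.2))
    · rintro ⟨i, b⟩ hx
      have hx' : (i, b) ∈ S := hx
      rw [hS, Finset.mem_filter, Finset.mem_product] at hx'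
      show _ ∈ Finset.filter _ _
      rw [Finset.mem_filter]
      exact ⟨hx'.2, (mem_cyc _ _ _).2 ⟨_, rfl⟩, iter_mem u D hD _ _ hx'.1.2⟩
    · rintro ⟨i, b⟩ hx ⟨j, c⟩ hy h
      have hx' : (i, b) ∈ S := hx
      have hy' : (j, c) ∈ S := hy
      rw [hS, Finset.mem_filter, Finset.mem_product, Finset.mem_range] at hx' hy'
      simp only [Prod.mk.injEq] at h
      have h2 := iter_inj u a hx'.1.1 hy'.1.1 h.1
      subst h2
      rw [u.injective.iterate _ h.2]
  refine le_trans ?_ h1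
  set G := D.filter fun b => (a < b ↔ u^[q] a < b) with hG
  set G' := D.filter fun b => ¬ (a < b ↔ u^[q] a < b) with hG'
  have hGG : G.card + G'.card = D.card := Finset.card_filter_add_card_filter_not _
  set H := D.filter fun b => ¬ (u^[q] a < b ↔ a < u^[p] b) with hH
  have hG1 : G.card ≤ (S.filter fun x => x.1 < q).card := by
    refine le_trans (Finset.card_le_card ?_) (Finset.card_image_le (f := Prod.snd))
    intro b hb
    rw [hG, Finset.mem_filter] at hb
    obtain ⟨i, -, h3, h4⟩ := exists_nv u a b (hne b hb.1) 0 q (by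
      rw [zero_add, hDq b hb.1]
      have := Nat.not_even_iff_odd.2 hq
      simp only [iterate_zero, id]
      tauto)
    rw [Finset.mem_image]
    refine ⟨(i, b), ?_, rfl⟩
    rw [Finset.mem_filter, hS, Finset.mem_filter, Finset.mem_product, Finset.mem_range]
    exact ⟨⟨⟨by simp only; omega, hb.1⟩, h4⟩, by simp only; omega⟩
  have hH1 : H.card ≤ (S.filter fun x => ¬ x.1 < q).card := by
    refine le_trans (Finset.card_le_card ?_) (Finset.card_image_le (f := Prod.snd))
    intro b hb
    rw [hH, Finset.mem_filter] at hb
    obtain ⟨i, h2, h3, h4⟩ := exists_nv u a b (hne b hb.1) q (p - q) (by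
      have e : q + (p - q) = p := by omega
      rw [e, hDq b hb.1, iterate_minimalPeriod]
      have := Nat.Odd.sub_odd hodd hq
      tauto)
    rw [Finset.mem_image]
    refine ⟨(i, b), ?_, rfl⟩
    rw [Finset.mem_filter, hS, Finset.mem_filter, Finset.mem_product, Finset.mem_range]
    exact ⟨⟨⟨by simp only; omega, hb.1⟩, h4⟩, by simp only; omega⟩
  have hS2 := Finset.card_filter_add_card_filter_not (s := S) (fun x => x.1 < q)
  have hmain : G'.card ≤ H.card := by
    set A := D.filter fun b => u^[q] a < b with hA
    set A' := D.filter fun b => a < b with hA'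
    set A'' := D.filter fun b => a < u^[p] b with hA''
    have himg : D.image (u^[p]) = D := by
      apply Finset.eq_of_subset_of_card_le
      · intro b hb
        obtain ⟨c, hc, rfl⟩ := Finset.mem_image.1 hb
        exact iter_mem u D hD _ _ hc
      · rw [Finset.card_image_of_injective _ (u.injective.iterate p)]
    have hcard : A''.card = A'.card := by
      have : A' = A''.image (u^[p]) := by
        rw [hA', hA'']
        conv_lhs => rw [← himg, Finset.filter_image]
      rw [this, Finset.card_image_of_injective _ (u.injective.iterate p)]
    rcases le_total a (u^[q] a) with hle | hle
    · have e1 : G' ⊆ A' \ A := by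
        intro b hb
        rw [hG', Finset.mem_filter] at hb
        rw [Finset.mem_sdiff, hA, hA', Finset.mem_filter, Finset.mem_filter]
        have := fun h : u^[q] a < b => lt_of_le_of_lt hle h
        tauto
      have e2 : A ⊆ A' := by
        intro b hb
        rw [hA, Finset.mem_filter] at hb
        rw [hA', Finset.mem_filter]
        exact ⟨hb.1, lt_of_le_of_lt hle hb.2⟩
      have e3 : A'' \ A ⊆ H := by
        intro b hb
        rw [Finset.mem_sdiff, hA, hA'', Finset.mem_filter, Finset.mem_filter] at hb
        rw [hH, Finset.mem_filter]
        tauto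
      have := Finset.card_le_card e1
      have := Finset.card_le_card e3
      have := Finset.le_card_sdiff A A''
      rw [Finset.card_sdiff_of_subset e2] at *
      omega
    · have e1 : G' ⊆ A \ A' := by
        intro b hb
        rw [hG', Finset.mem_filter] at hb
        rw [Finset.mem_sdiff, hA, hA', Finset.mem_filter, Finset.mem_filter]
        have := fun h : a < b => lt_of_le_of_lt hle h
        tauto
      have e2 : A' ⊆ A := by
        intro b hb
        rw [hA', Finset.mem_filter] at hb
        rw [hA, Finset.mem_filter]
        exact ⟨hb.1, lt_of_le_of_lt hle hb.2⟩
      have e3 : A \ A'' ⊆ H := by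
        intro b hb
        rw [Finset.mem_sdiff, hA, hA'', Finset.mem_filter, Finset.mem_filter] at hb
        rw [hH, Finset.mem_filter]
        tauto
      have := Finset.card_le_card e1
      have := Finset.card_le_card e3
      have := Finset.le_card_sdiff A'' A
      have := Finset.card_sdiff_of_subset e2
      omega
  omega

theorem mixed_all {n : ℕ} (u : Perm (Fin n)) (a : Fin n)
    (hodd : ∀ b, Odd (minimalPeriod u b)) (hle : ∀ b, minimalPeriod u b ≤ minimalPeriod u a) :
    n - minimalPeriod u a ≤
      ((NV u).filter fun x => x.1 ∈ cyc u a ∧ x.2 ∉ cyc u a).card := by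
  have h0 : n - minimalPeriod u a = ((cyc u a)ᶜ).card := by
    rw [Finset.card_compl, Fintype.card_fin, card_cyc]
  rw [h0, Finset.card_eq_sum_card_fiberwise (f := fun b => minimalPeriod u b)
      (t := Finset.range (minimalPeriod u a + 1)) (s := (cyc u a)ᶜ),
    Finset.card_eq_sum_card_fiberwise (f := fun x : Fin n × Fin n => minimalPeriod u x.2)
      (t := Finset.range (minimalPeriod u a + 1))
      (s := (NV u).filter fun x => x.1 ∈ cyc u a ∧ x.2 ∉ cyc u a)]
  · apply Finset.sum_le_sum
    intro q hq
    by_cases hqo : Odd q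
    · refine le_trans (mixed u a (hodd a) q hqo (by simpa [Nat.lt_succ_iff] using hq) _ ?_ ?_ ?_)
        (Finset.card_le_card ?_)
      · intro b hb
        rw [Finset.mem_filter, Finset.mem_compl] at hb ⊢
        rw [apply_mem_cyc, minimalPeriod_apply (u.injective.mem_periodicPts b)]
        exact hb
      · intro b hb
        rw [Finset.mem_filter] at hb
        rw [← hb.2]
        exact iterate_minimalPeriod
      · intro b hb
        rw [Finset.mem_filter, Finset.mem_compl] at hb
        exact hb.1
      · intro x hx
        simp only [Finset.mem_filter, Finset.mem_compl] at hx ⊢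
        tauto
    · rw [Finset.card_eq_zero.2]
      · exact Nat.zero_le _
      · rw [Finset.filter_eq_empty_iff]
        rintro b - rfl
        exact hqo (hodd b)
  · intro x _
    simpa [Nat.lt_succ_iff] using hle x.2
  · intro x _
    simpa [Nat.lt_succ_iff] using hle x

theorem lower_bound {n : ℕ} (u : Perm (Fin n)) (a : Fin n)
    (hodd : ∀ b, Odd (minimalPeriod u b)) (hle : ∀ b, minimalPeriod u b ≤ minimalPeriod u a) :
    ((NV u).filter fun x => x.1 ∉ cyc u a ∧ x.2 ∉ cyc u a).card + (minimalPeriod u a - 1) +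
      2 * (n - minimalPeriod u a) ≤ (NV u).card := by
  have h1 := within u a (hodd a)
  have h2 := mixed_all u a hodd hle
  have h3 : ((NV u).filter fun x => x.1 ∈ cyc u a ∧ x.2 ∉ cyc u a).card =
      ((NV u).filter fun x => x.1 ∉ cyc u a ∧ x.2 ∈ cyc u a).card := by
    refine Finset.card_bij' (fun x _ => (x.2, x.1)) (fun x _ => (x.2, x.1)) ?_ ?_ ?_ ?_
    · rintro ⟨x, y⟩ h
      rw [Finset.mem_filter] at h ⊢
      exact ⟨mem_NV_swap _ _ _ h.1, h.2.2, h.2.1⟩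
    · rintro ⟨x, y⟩ h
      rw [Finset.mem_filter] at h ⊢
      exact ⟨mem_NV_swap _ _ _ h.1, h.2.2, h.2.1⟩
    · rintro ⟨x, y⟩ _; rfl
    · rintro ⟨x, y⟩ _; rfl
  have h4 := Finset.card_filter_add_card_filter_not (s := NV u) (fun x => x.1 ∈ cyc u a)
  have h5 := Finset.card_filter_add_card_filter_not
    (s := (NV u).filter (fun x => x.1 ∈ cyc u a)) (fun x => x.2 ∈ cyc u a)
  have h6 := Finset.card_filter_add_card_filter_not
    (s := (NV u).filter (fun x => ¬ x.1 ∈ cyc u a)) (fun x => x.2 ∈ cyc u a)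
  simp only [Finset.filter_filter] at h5 h6
  omega

/-- positions of the long cycle -/
def gpos (n i : ℕ) : ℕ := if i % 2 = 0 then i / 2 else n - 1 - i / 2

theorem exists_relabel {n : ℕ} (u : Perm (Fin n)) (a : Fin n) (m : ℕ)
    (hp : minimalPeriod u a = 2 * m + 1) :
    ∃ e : Perm (Fin n), (∀ i, i < 2 * m + 1 → (e (u^[i] a)).val = gpos n i) ∧
      (∀ b, b ∉ cyc u a → m < (e b).val ∧ (e b).val < n - m) ∧
      (∀ b c, b ∉ cyc u a → c ∉ cyc u a → b < c → e b < e c) := by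
  have hn : 2 * m + 1 ≤ n := by
    rw [← hp, ← card_cyc]
    simpa using Finset.card_le_univ (cyc u a)
  have hidx : ∀ b, b ∈ cyc u a → ∃ i, i < 2 * m + 1 ∧ u^[i] a = b := by
    intro b hb
    rw [cyc, Finset.mem_image] at hb
    obtain ⟨i, hi, h⟩ := hb
    exact ⟨i, by rw [Finset.mem_range, hp] at hi; exact hi, h⟩
  choose! idx hidx1 hidx2 using hidx
  let cnt : Fin n → ℕ := fun b => ((cyc u a)ᶜ.filter fun c => c < b).card
  have hcnt : ∀ b, b ∉ cyc u a → cnt b < n - (2 * m + 1) := by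
    intro b hb
    have h0 : n - (2 * m + 1) = ((cyc u a)ᶜ).card := by
      rw [Finset.card_compl, Fintype.card_fin, card_cyc, hp]
    rw [h0]
    apply Finset.card_lt_card
    rw [Finset.filter_ssubset]
    exact ⟨b, by simpa using hb, lt_irrefl b⟩
  have hcnt2 : ∀ b c, b ∉ cyc u a → c ∉ cyc u a → b < c → cnt b < cnt c := by
    intro b c hb hc hbc
    apply Finset.card_lt_card
    rw [Finset.ssubset_iff_of_subset]
    · exact ⟨b, by simp [hb, hbc], by simp⟩
    · intro x hx
      rw [Finset.mem_filter] at hx ⊢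
      exact ⟨hx.1, hx.2.trans hbc⟩
  have hg : ∀ i, i < 2 * m + 1 → gpos n i ≤ m ∨ (n - m ≤ gpos n i ∧ gpos n i < n) := by
    intro i hi
    unfold gpos
    split_ifs <;> omega
  have hginj : ∀ i j, i < 2 * m + 1 → j < 2 * m + 1 → gpos n i = gpos n j → i = j := by
    intro i j hi hj h
    unfold gpos at h
    split_ifs at h <;> omega
  let f : Fin n → ℕ := fun b => if b ∈ cyc u a then gpos n (idx b) else m + 1 + cnt b
  have hf1 : ∀ b, b ∈ cyc u a → f b = gpos n (idx b) := fun b hb => if_pos hb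
  have hf2 : ∀ b, b ∉ cyc u a → f b = m + 1 + cnt b := fun b hb => if_neg hb
  have hfn : ∀ b, f b < n := by
    intro b
    by_cases hb : b ∈ cyc u a
    · rw [hf1 b hb]
      have := hg _ (hidx1 b hb)
      omega
    · rw [hf2 b hb]
      have := hcnt b hb
      omega
  have hfinj : ∀ b c, f b = f c → b = c := by
    intro b c h
    by_cases hb : b ∈ cyc u a <;> by_cases hc : c ∈ cyc u a
    · rw [hf1 b hb, hf1 c hc] at h
      rw [← hidx2 b hb, ← hidx2 c hc, hginj _ _ (hidx1 b hb) (hidx1 c hc) h]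
    · rw [hf1 b hb, hf2 c hc] at h
      have := hg _ (hidx1 b hb)
      have := hcnt c hc
      omega
    · rw [hf2 b hb, hf1 c hc] at h
      have := hg _ (hidx1 c hc)
      have := hcnt b hb
      omega
    · rw [hf2 b hb, hf2 c hc] at h
      rcases lt_trichotomy b c with h1 | h1 | h1
      · have := hcnt2 b c hb hc h1; omega
      · exact h1
      · have := hcnt2 c b hc hb h1; omega
  let F : Fin n → Fin n := fun b => ⟨f b, hfn b⟩
  have hF : Function.Bijective F := by
    apply Finite.injective_iff_bijective.1
    intro b c h
    exact hfinj b c (congrArg Fin.val h)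
  refine ⟨Equiv.ofBijective F hF, ?_, ?_, ?_⟩
  · intro i hi
    have hm : u^[i] a ∈ cyc u a := (mem_cyc _ _ _).2 ⟨i, rfl⟩
    have h1 : idx (u^[i] a) = i :=
      iter_inj u a (by rw [hp]; exact hidx1 _ hm) (by rw [hp]; exact hi) (hidx2 _ hm)
    show f (u^[i] a) = _
    rw [hf1 _ hm, h1]
  · intro b hb
    show m < f b ∧ f b < n - m
    rw [hf2 b hb]
    have := hcnt b hb
    omega
  · intro b c hb hc hbc
    show f b < f c
    rw [hf2 b hb, hf2 c hc]
    have := hcnt2 b c hb hc hbc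
    omega

theorem upper_bound {n : ℕ} (u e : Perm (Fin n)) (a : Fin n) (m : ℕ)
    (hp : minimalPeriod u a = 2 * m + 1) (hn : 2 * m + 1 ≤ n)
    (h1 : ∀ i, i < 2 * m + 1 → (e (u^[i] a)).val = gpos n i)
    (h2 : ∀ b, b ∉ cyc u a → m < (e b).val ∧ (e b).val < n - m)
    (h3 : ∀ b c, b ∉ cyc u a → c ∉ cyc u a → b < c → e b < e c) :
    (NV (e * u * e⁻¹)).card ≤
    ((NV u).filter fun x => x.1 ∉ cyc u a ∧ x.2 ∉ cyc u a).card + (2 * m) +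
      2 * (n - (2 * m + 1)) := by
  set t := u^[2 * m] a with ht
  set B := (Finset.range m).image (fun j => u^[2 * j + 1] a) ∪ (cyc u a)ᶜ with hB
  set T := Finset.univ.filter fun x : Fin n × Fin n =>
    x.1 ≠ x.2 ∧ (e x.1 < e x.2 ↔ e (u x.1) < e (u x.2)) with hT
  have hBc : B.card ≤ m + (n - (2 * m + 1)) := by
    refine (Finset.card_union_le _ _).trans (Nat.add_le_add ?_ ?_)
    · exact Finset.card_image_le.trans (by simp)
    · rw [Finset.card_compl, Fintype.card_fin, card_cyc, hp]
  have hTc : (NV (e * u * e⁻¹)).card = T.card := by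
    have hE1 : ∀ z, e (e⁻¹ z) = z := fun z => e.apply_symm_apply z
    have hE2 : ∀ z, e⁻¹ (e z) = z := fun z => e.symm_apply_apply z
    refine Finset.card_bij' (fun x _ => (e⁻¹ x.1, e⁻¹ x.2)) (fun x _ => (e x.1, e x.2)) ?_ ?_ ?_ ?_
    · rintro ⟨x, y⟩ h
      rw [mem_NV] at h
      rw [hT, Finset.mem_filter]
      simp only [Finset.mem_univ, true_and, Perm.mul_apply, hE1] at h ⊢
      exact ⟨fun hh => h.1 (e⁻¹.injective hh), h.2⟩
    · rintro ⟨x, y⟩ h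
      rw [hT, Finset.mem_filter] at h
      rw [mem_NV]
      simp only [Finset.mem_univ, true_and, Perm.mul_apply, hE2] at h ⊢
      exact ⟨fun hh => h.1 (e.injective hh), h.2⟩
    · rintro ⟨x, y⟩ _; simp
    · rintro ⟨x, y⟩ _; simp
  have hidx : ∀ b, b ∈ cyc u a → ∃ i, i < 2 * m + 1 ∧ u^[i] a = b := by
    intro b hb
    rw [cyc, Finset.mem_image] at hb
    obtain ⟨i, hi, h⟩ := hb
    exact ⟨i, by rw [Finset.mem_range, hp] at hi; exact hi, h⟩
  have hnext : ∀ i, i < 2 * m → (e (u (u^[i] a))).val = gpos n (i + 1) := by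
    intro i hi
    rw [← iterate_succ_apply' u]
    exact h1 _ (by omega)
  have hlast : (e (u (u^[2 * m] a))).val = 0 := by
    rw [← iterate_succ_apply' u]
    have e1 : (2 * m).succ = minimalPeriod u a := by rw [hp]
    rw [e1, iterate_minimalPeriod]
    have := h1 0 (by omega)
    simpa [gpos] using this
  have key : ∀ x y, x ∈ cyc u a → (x, y) ∈ T → (x = t ∧ y ∈ B) ∨ (x ∈ B ∧ y = t) := by
    intro x y hx hxy
    rw [hT, Finset.mem_filter] at hxy
    obtain ⟨-, hne, hiff⟩ := hxy
    simp only [Fin.lt_def] at hne hiff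
    obtain ⟨i, hi, rfl⟩ := hidx x hx
    have vi := h1 i hi
    by_cases hy : y ∈ cyc u a
    · obtain ⟨k, hk, rfl⟩ := hidx y hy
      have hik : i ≠ k := fun h => hne (by rw [h])
      have vk := h1 k hk
      by_cases hi2 : i = 2 * m
      · subst hi2
        left
        refine ⟨rfl, ?_⟩
        rw [hB, Finset.mem_union, Finset.mem_image]
        left
        have vk' := hnext k (by omega)
        rw [vi, vk, hlast, vk'] at hiff
        have hko : k % 2 = 1 := by
          by_contra hcon
          unfold gpos at hiff
          rw [if_pos (by omega), if_pos (by omega), if_neg (by omega)] at hiff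
          omega
        exact ⟨k / 2, by rw [Finset.mem_range]; omega, by congr 2; omega⟩
      · have vi' := hnext i (by omega)
        by_cases hk2 : k = 2 * m
        · subst hk2
          right
          refine ⟨?_, rfl⟩
          rw [hB, Finset.mem_union, Finset.mem_image]
          left
          rw [vi, vk, hlast, vi'] at hiff
          have hko : i % 2 = 1 := by
            by_contra hcon
            unfold gpos at hiff
            rw [if_pos (by omega), if_pos (by omega), if_neg (by omega)] at hiff
            omega
          exact ⟨i / 2, by rw [Finset.mem_range]; omega, by congr 2; omega⟩
        · exfalso
          have vk' := hnext k (by omega)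
          rw [vi, vk, vi', vk'] at hiff
          unfold gpos at hiff
          split_ifs at hiff <;> omega
    · have hy2 : u y ∉ cyc u a := by rwa [apply_mem_cyc]
      have v1 := h2 y hy
      have v2 := h2 _ hy2
      by_cases hi2 : i = 2 * m
      · left
        subst hi2
        exact ⟨rfl, by rw [hB, Finset.mem_union, Finset.mem_compl]; exact Or.inr hy⟩
      · exfalso
        have vi' := hnext i (by omega)
        rw [vi, vi'] at hiff
        unfold gpos at hiff
        split_ifs at hiff <;> omega
  have hsymm : ∀ x y, (x, y) ∈ T → (y, x) ∈ T := by
    intro x y h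
    rw [hT, Finset.mem_filter] at h ⊢
    obtain ⟨-, hne, hiff⟩ := h
    refine ⟨Finset.mem_univ _, hne.symm, ?_⟩
    have n1 : (e x).val ≠ (e y).val := fun h => hne (e.injective (Fin.ext h))
    have n2 : (e (u x)).val ≠ (e (u y)).val :=
      fun h => hne (u.injective (e.injective (Fin.ext h)))
    simp only [Fin.lt_def] at hiff ⊢
    omega
  have hsub : T ⊆ (((NV u).filter fun x => x.1 ∉ cyc u a ∧ x.2 ∉ cyc u a) ∪ {t} ×ˢ B) ∪
      B ×ˢ {t} := by
    rintro ⟨x, y⟩ h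
    simp only [Finset.mem_union, Finset.mem_product, Finset.mem_singleton]
    by_cases hx : x ∈ cyc u a
    · have := key x y hx h
      tauto
    · by_cases hy : y ∈ cyc u a
      · have := key y x hy (hsymm _ _ h)
        tauto
      · left; left
        rw [Finset.mem_filter, mem_NV]
        rw [hT, Finset.mem_filter] at h
        obtain ⟨-, hne, hiff⟩ := h
        have mono : ∀ b c, b ∉ cyc u a → c ∉ cyc u a → (e b < e c ↔ b < c) := by
          intro b c hb hc
          constructor
          · intro hlt
            rcases lt_trichotomy b c with h4 | h4 | h4
            · exact h4
            · rw [h4] at hlt; exact absurd hlt (lt_irrefl _)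
            · exact absurd hlt (h3 c b hc hb h4).not_gt
          · exact h3 b c hb hc
        simp only at hne hiff
        rw [mono x y hx hy, mono (u x) (u y) (by rwa [apply_mem_cyc]) (by rwa [apply_mem_cyc])]
          at hiff
        exact ⟨⟨hne, hiff⟩, hx, hy⟩
  rw [hTc]
  have c1 := Finset.card_le_card hsub
  have c2 := Finset.card_union_le
    (((NV u).filter fun x => x.1 ∉ cyc u a ∧ x.2 ∉ cyc u a) ∪ {t} ×ˢ B) (B ×ˢ {t})
  have c3 := Finset.card_union_le
    ((NV u).filter fun x => x.1 ∉ cyc u a ∧ x.2 ∉ cyc u a) ({t} ×ˢ B)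
  rw [Finset.card_product, Finset.card_singleton] at c2 c3
  omega

theorem pigeon {n : ℕ} (x : Perm (Fin n)) (b : ℕ)
    (h : ∀ j : Fin n, j.val < b → (x j).val < b) (j : Fin n) (hj : b ≤ j.val) :
    b ≤ (x j).val := by
  by_contra hcon
  set S := Finset.univ.filter fun j : Fin n => j.val < b with hS
  have himg : S.image x = S := by
    apply Finset.eq_of_subset_of_card_le
    · intro c hc
      obtain ⟨d, hd, rfl⟩ := Finset.mem_image.1 hc
      rw [hS, Finset.mem_filter] at hd ⊢
      exact ⟨Finset.mem_univ _, h d hd.2⟩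
    · rw [Finset.card_image_of_injective _ x.injective]
  have h1 : x j ∈ S.image x := by
    rw [himg, hS, Finset.mem_filter]
    exact ⟨Finset.mem_univ _, by omega⟩
  obtain ⟨d, hd, hdj⟩ := Finset.mem_image.1 h1
  rw [hS, Finset.mem_filter, x.injective hdj] at hd
  omega

theorem long_cycle {n m : ℕ} (hn : 2 * m + 1 ≤ n) (x : Perm (Fin n))
    (hodd : ∀ b, Odd (minimalPeriod (x * Fin.revPerm : Perm (Fin n)) b))
    (hfix : ∀ b, n - m ≤ b → ∀ j : Fin n, j.val < b → (x j).val < b)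
    (hshift : ∀ i, i ≤ m → ∀ j : Fin n, j.val < i → (x j).val < i + 1) :
    ∃ b, 2 * m + 1 ≤ minimalPeriod (x * Fin.revPerm : Perm (Fin n)) b := by
  set u : Perm (Fin n) := x * Fin.revPerm with hu
  have hx1 : ∀ j : Fin n, n - m ≤ j.val → (x j).val = j.val := by
    intro j hj
    have h1 := pigeon x j.val (hfix _ hj) j le_rfl
    have h2 := hfix (j.val + 1) (by omega) j (by omega)
    omega
  have hux : ∀ j : Fin n, u j = x (Fin.rev j) := fun j => rfl
  have hulow : ∀ j : Fin n, j.val < m → (u j).val = n - 1 - j.val := by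
    intro j hj
    rw [hux, hx1, Fin.val_rev]
    · omega
    · rw [Fin.val_rev]; omega
  have hx2 : ∀ i, i < m → ∀ j : Fin n, j.val = i → (x j).val = i + 1 := by
    intro i
    induction i using Nat.strong_induction_on with
    | _ i ih =>
      intro hi j hj
      by_contra hne
      have h1 := hshift (i + 1) (by omega) j (by omega)
      have h0 : (x j).val = 0 := by
        by_contra h0
        have h2 := ih ((x j).val - 1) (by omega) (by omega) ⟨(x j).val - 1, by omega⟩ rfl
        have h3 : x ⟨(x j).val - 1, by omega⟩ = x j := Fin.ext (by omega)
        have h4 := congrArg Fin.val (x.injective h3)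
        simp only at h4
        omega
      have hmap : ∀ c : Fin n, c.val < i + 1 → (x c).val < i + 1 := by
        intro c hc
        by_cases hci : c.val = i
        · have : c = j := Fin.ext (by omega)
          rw [this]; omega
        · have := ih c.val (by omega) (by omega) c rfl
          omega
      let o : Fin n := ⟨0, by omega⟩
      have hit : ∀ k, (u^[2 * k] o).val < i + 1 := by
        intro k
        induction k with
        | zero => simp [o]
        | succ k ihk =>
          have e : 2 * (k + 1) = (2 * k).succ.succ := by omega
          rw [e, iterate_succ_apply', iterate_succ_apply']
          have h5 := hulow (u^[2 * k] o) (by omega)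
          rw [hux (u (u^[2 * k] o))]
          apply hmap
          rw [Fin.val_rev]
          omega
      obtain ⟨k, hk⟩ := hodd o
      have h6 : u^[minimalPeriod u o] o = o := iterate_minimalPeriod
      have h7 := hit k
      rw [hk, show 2 * k + 1 = (2 * k).succ from rfl, iterate_succ_apply'] at h6
      have h8 := hulow _ (show (u^[2 * k] o).val < m by omega)
      rw [h6] at h8
      have h9 : o.val = 0 := rfl
      omega
  let o : Fin n := ⟨0, by omega⟩
  have hit : ∀ k, k ≤ m → (u^[2 * k] o).val = k := by
    intro k
    induction k with
    | zero => simp [o]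
    | succ k ihk =>
      intro hk
      have e : 2 * (k + 1) = (2 * k).succ.succ := by omega
      rw [e, iterate_succ_apply', iterate_succ_apply']
      have h4 := ihk (by omega)
      have h5 := hulow (u^[2 * k] o) (by omega)
      rw [hux (u (u^[2 * k] o))]
      apply hx2 k (by omega)
      rw [Fin.val_rev]
      omega
  refine ⟨o, ?_⟩
  by_contra hcon
  obtain ⟨k, hk⟩ := hodd o
  have h6 : u^[minimalPeriod u o] o = o := iterate_minimalPeriod
  have h7 := hit k (by omega)
  rw [hk, show 2 * k + 1 = (2 * k).succ from rfl, iterate_succ_apply'] at h6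
  have h8 := hulow _ (show (u^[2 * k] o).val < m by omega)
  rw [h6] at h8
  have h9 : o.val = 0 := rfl
  omega

/-- Lemma: if `λ`, `μ` are partitions of `n` with all parts odd and `O_λ ≤ O_μ`, then
the largest part of `μ` is at most the largest part of `λ`. -/
theorem stmt7 (n : ℕ) (lam mu : Multiset ℕ)
    (hlsum : lam.sum = n) (hmsum : mu.sum = n)
    (hlodd : ∀ p ∈ lam, Odd p) (hmodd : ∀ p ∈ mu, Odd p)
    (h : classLE n lam mu) :
    mu.sup ≤ lam.sup := by
  classical
  rcases mu.toFinset.eq_empty_or_nonempty with h0 | h0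
  · rw [Multiset.toFinset_eq_empty] at h0
    simp [h0]
  obtain ⟨p, hpm, hpmax⟩ := Finset.exists_max_image mu.toFinset id h0
  rw [Multiset.mem_toFinset] at hpm
  refine le_trans (Multiset.sup_le.2 fun b hb => hpmax b (Multiset.mem_toFinset.2 hb)) ?_
  simp only [id] at hpmax ⊢
  obtain ⟨m, hm⟩ := hmodd p hpm
  obtain ⟨u0, hu0⟩ := exists_fullCycleType n mu hmsum (fun p hp => (hmodd p hp).pos)
  have hrr : (Fin.revPerm : Perm (Fin n)) * Fin.revPerm = 1 := by
    ext i; simp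
  have hcl : ∀ v : Perm (Fin n), (v * Fin.revPerm) * Fin.revPerm = v := fun v => by
    rw [mul_assoc, hrr, mul_one]
  obtain ⟨w, hw, hwmin⟩ := Finset.exists_min_image
    (Finset.univ.filter fun w : Perm (Fin n) => inClass n mu w) (permLength n)
    ⟨u0 * Fin.revPerm, by
      refine Finset.mem_filter.2 ⟨Finset.mem_univ _, ?_⟩
      unfold inClass
      rw [hcl, hu0]⟩
  simp only [Finset.mem_filter, Finset.mem_univ, true_and] at hw hwmin
  set u : Perm (Fin n) := w * Fin.revPerm with hu
  have hut : fullCycleType n u = mu := hw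
  obtain ⟨a, ha⟩ := (mem_fullCycleType_iff u p).1 (hut ▸ hpm)
  have hmem : ∀ b, minimalPeriod u b ∈ mu := fun b => by
    rw [← hut]; exact (mem_fullCycleType_iff u _).2 ⟨b, rfl⟩
  have hodd : ∀ b, Odd (minimalPeriod u b) := fun b => hmodd _ (hmem b)
  have hle : ∀ b, minimalPeriod u b ≤ minimalPeriod u a := fun b => by
    rw [ha]; exact hpmax _ (Multiset.mem_toFinset.2 (hmem b))
  have hp : minimalPeriod u a = 2 * m + 1 := ha.trans hm
  have hn : 2 * m + 1 ≤ n := by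
    rw [← hp, ← card_cyc]
    simpa using Finset.card_le_univ (cyc u a)
  obtain ⟨e, h1, h2, h3⟩ := exists_relabel u a m hp
  have hlow := lower_bound u a hodd hle
  have hup := upper_bound u e a m hp hn h1 h2 h3
  set x : Perm (Fin n) := (e * u * e⁻¹) * Fin.revPerm with hx
  have hxu : x * Fin.revPerm = e * u * e⁻¹ := hcl _
  have hxclass : inClass n mu x := by
    unfold inClass
    rw [hxu, fullCycleType_conj, hut]
  have hxlen : permLength n x ≤ permLength n w := by
    have c1 := card_NV x
    have c2 := card_NV w
    rw [hxu] at c1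
    rw [← hu] at c2
    rw [hp] at hlow
    rw [permLength_eq, permLength_eq]
    omega
  have hxmin : isMinimalIn n mu x :=
    ⟨hxclass, fun z hz => hxlen.trans (hwmin z hz)⟩
  obtain ⟨x', hx', hbr⟩ := h x hxmin
  have hxj : ∀ (j : Fin n) (z : Fin n), Fin.rev j = e z → x j = e (u z) := by
    intro j z hz
    have hE2 : e⁻¹ (e z) = z := e.symm_apply_apply z
    simp only [hx, Perm.mul_apply, Fin.revPerm_apply, hz, hE2]
  have hA : ∀ j : Fin n, j.val < m → (x j).val = j.val + 1 := by
    intro j hj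
    have hz : Fin.rev j = e (u^[2 * j.val + 1] a) := by
      apply Fin.ext
      rw [h1 _ (by omega), Fin.val_rev, gpos, if_neg (by omega)]
      omega
    rw [hxj j _ hz, ← iterate_succ_apply' (⇑u), h1 _ (by omega), gpos, if_pos (by omega)]
    omega
  have hB : ∀ j : Fin n, n - m ≤ j.val → x j = j := by
    intro j hj
    have hjn := j.isLt
    have hz : Fin.rev j = e (u^[2 * (n - 1 - j.val)] a) := by
      apply Fin.ext
      rw [h1 _ (by omega), Fin.val_rev, gpos, if_pos (by omega)]
      omega
    apply Fin.ext
    rw [hxj j _ hz, ← iterate_succ_apply' (⇑u), h1 _ (by omega), gpos, if_neg (by omega)]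
    omega
  have hfix : ∀ b, n - m ≤ b → ∀ j : Fin n, j.val < b → (x j).val < b := by
    intro b hb j hj
    by_contra hc
    have h5 := x.injective (hB (x j) (by omega))
    rw [h5] at hc
    omega
  have hshift : ∀ i, i ≤ m → ∀ j : Fin n, j.val < i → (x j).val < i + 1 := by
    intro i hi j hj
    rw [hA j (by omega)]
    omega
  have hmem' : ∀ b, minimalPeriod (x' * Fin.revPerm : Perm (Fin n)) b ∈ lam := fun b => by
    have h6 : fullCycleType n (x' * Fin.revPerm) = lam := hx'.1
    rw [← h6]
    exact (mem_fullCycleType_iff _ _).2 ⟨b, rfl⟩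
  obtain ⟨b, hb⟩ := long_cycle hn x' (fun b => hlodd _ (hmem' b))
    (fun b hb => bruhat_maps x' x hbr b b (hfix b hb))
    (fun i hi => bruhat_maps x' x hbr i (i + 1) (hshift i hi))
  rw [hm]
  exact hb.trans (Multiset.le_sup (hmem' b))
end
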